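/- arXiv:2301.00569 — 2 statements merged into one kernel-verified Lean document; each statement's English description precedes it below -/
import Mathlib

section
/- Let (R, m) be a one-dimensional Cohen-Macaulay local ring. Then the Elias index eli(R) (the smallest s such that m^s is Elias) equals 1 if and only if R is regular. -/
open CategoryTheory IsLocalRing

universe u

/-- The length of a module, as the Krull dimension of its submodule lattice. -/
noncomputable def rlength (R : Type u) (M : Type*) [Ring R] [AddCommGroup M]
    [Module R M] : WithBot ℕ∞ :=
  Order.krullDim (Submodule R M)

/-- `dim_k Ext^1_R(k, M)` (measured as `R`-length, which agrees with `k`-dimension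
since the module is killed by the maximal ideal). -/
noncomputable def modType (R : Type u) [CommRing R] [IsLocalRing R]
    (M : ModuleCat.{u} R) : WithBot ℕ∞ :=
  rlength R (((_root_.Ext R (ModuleCat.{u} R) 1).obj
    (Opposite.op (ModuleCat.of R (ResidueField R)))).obj M)

/-- The Cohen–Macaulay type of an `m`-primary ideal `I`:  `dim_k Ext^1_R(k, I)`. -/
noncomputable def idealType (R : Type u) [CommRing R] [IsLocalRing R] (I : Ideal R) :
    WithBot ℕ∞ :=
  modType R (ModuleCat.of R I)

/-- The Cohen–Macaulay type of `R/I`: `dim_k Hom_R(k, R/I)`. -/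
noncomputable def quotType (R : Type u) [CommRing R] [IsLocalRing R] (I : Ideal R) :
    WithBot ℕ∞ :=
  rlength R (ResidueField R →ₗ[R] R ⧸ I)

/-- An ideal is `m`-primary iff its radical is the maximal ideal. -/
def IsMPrimary (R : Type u) [CommRing R] [IsLocalRing R] (I : Ideal R) : Prop :=
  I.radical = maximalIdeal R

/-- `I` is Elias if `type(I) = type(R/I)`. -/
def EliasIdeal (R : Type u) [CommRing R] [IsLocalRing R] (I : Ideal R) : Prop :=
  idealType R I = quotType R I

/-- The minimal number of generators, as `dim_k I/mI`. -/
noncomputable def mu (R : Type u) [CommRing R] [IsLocalRing R] (I : Ideal R) :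
    WithBot ℕ∞ :=
  rlength R (I ⧸ (maximalIdeal R • ⊤ : Submodule R I))

/-- `R` has Hilbert–Samuel multiplicity `e`. -/
def HasMultiplicity (R : Type u) [CommRing R] [IsLocalRing R] (e : ℕ) : Prop :=
  ∃ N : ℕ, ∀ n ≥ N,
    rlength R (R ⧸ (maximalIdeal R) ^ (n + 1)) =
      rlength R (R ⧸ (maximalIdeal R) ^ n) + (e : WithBot ℕ∞)

theorem rlength_eq_one_iff {R : Type u} {M : Type*} [Ring R] [AddCommGroup M] [Module R M] :
    rlength R M = 1 ↔ IsSimpleModule R M := by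
  rw [rlength, ← Module.coe_length, ← Module.length_eq_one_iff]
  norm_cast

/-- Two presentations of the same module, one of them continuing to the left as a projective
resolution, compute the same first cohomology of `Hom(-, M)`. -/
theorem exists_lift_to_ker {R P₂ P₁ P₀ X F M : Type*} [CommRing R]
    [AddCommGroup P₂] [Module R P₂] [AddCommGroup P₁] [Module R P₁]
    [AddCommGroup P₀] [Module R P₀] [AddCommGroup X] [Module R X]
    [AddCommGroup F] [Module R F] [AddCommGroup M] [Module R M]
    [Module.Projective R P₀] [Module.Projective R F]
    (d₂ : P₂ →ₗ[R] P₁) (d₁ : P₁ →ₗ[R] P₀) (ε : P₀ →ₗ[R] X) (q : F →ₗ[R] X)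
    (h₁ : Function.Exact d₂ d₁) (h₀ : Function.Exact d₁ ε)
    (hε : Function.Surjective ε) (hq : Function.Surjective q) :
    ∃ φ : P₁ →ₗ[R] LinearMap.ker q, φ ∘ₗ d₂ = 0 ∧
      (∀ h : P₁ →ₗ[R] M, h ∘ₗ d₂ = 0 →
        ∃ (g : LinearMap.ker q →ₗ[R] M) (f : P₀ →ₗ[R] M), g ∘ₗ φ + f ∘ₗ d₁ = h) ∧
      ∀ g : LinearMap.ker q →ₗ[R] M, (∃ f : P₀ →ₗ[R] M, f ∘ₗ d₁ = g ∘ₗ φ) ↔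
        ∃ f : F →ₗ[R] M, f ∘ₗ (LinearMap.ker q).subtype = g := by
  obtain ⟨φ₀, hφ₀⟩ := Module.projective_lifting_property q ε hq
  obtain ⟨ψ₀, hψ₀⟩ := Module.projective_lifting_property ε q hε
  have hφ₀' (x) : q (φ₀ x) = ε x := LinearMap.congr_fun hφ₀ x
  have hψ₀' (x) : ε (ψ₀ x) = q x := LinearMap.congr_fun hψ₀ x
  let φ : P₁ →ₗ[R] LinearMap.ker q := (φ₀ ∘ₗ d₁).codRestrict _ fun x ↦ by
    simp [hφ₀', h₀.apply_apply_eq_zero]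
  refine ⟨φ, ?_, fun h hh ↦ ?_, fun g ↦ ⟨?_, ?_⟩⟩
  · ext x
    simp [φ, h₁.apply_apply_eq_zero]
  · let d : P₁ →ₗ[R] LinearMap.ker ε := d₁.codRestrict _ h₀.apply_apply_eq_zero
    have hd : Function.Surjective d := fun y ↦ by
      obtain ⟨x, hx⟩ := (h₀ y.1).1 y.2
      exact ⟨x, Subtype.ext hx⟩
    have hk : LinearMap.ker d ≤ LinearMap.ker h := fun x hx ↦ by
      obtain ⟨y, rfl⟩ := (h₁ x).1 (congrArg Subtype.val hx)
      exact LinearMap.congr_fun hh y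
    let e := d.quotKerEquivOfSurjective hd
    let h' : LinearMap.ker ε →ₗ[R] M := (LinearMap.ker d).liftQ h hk ∘ₗ e.symm.toLinearMap
    have hh' (x) : h' (d x) = h x := by
      have : e.symm (d x) = Submodule.Quotient.mk x := by
        rw [LinearEquiv.symm_apply_eq]; rfl
      simp [h', this]
    let ψ : LinearMap.ker q →ₗ[R] LinearMap.ker ε :=
      (ψ₀ ∘ₗ (LinearMap.ker q).subtype).codRestrict _ fun x ↦ by simp [hψ₀']
    let s : P₀ →ₗ[R] LinearMap.ker ε := (LinearMap.id - ψ₀ ∘ₗ φ₀).codRestrict _ fun x ↦ by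
      simp [hψ₀', hφ₀']
    refine ⟨h' ∘ₗ ψ, h' ∘ₗ s, ?_⟩
    ext x
    rw [← hh' x]
    simp only [LinearMap.add_apply, LinearMap.comp_apply, ← map_add]
    congr 1
    ext
    change ψ₀ (φ₀ (d₁ x)) + (d₁ x - ψ₀ (φ₀ (d₁ x))) = d₁ x
    abel
  · rintro ⟨f, hf⟩
    let s : F →ₗ[R] LinearMap.ker q := (LinearMap.id - φ₀ ∘ₗ ψ₀).codRestrict _ fun x ↦ by
      simp [hψ₀', hφ₀']
    refine ⟨f ∘ₗ ψ₀ + g ∘ₗ s, ?_⟩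
    ext x
    obtain ⟨y, hy⟩ := (h₀ (ψ₀ x)).1 (by simp [hψ₀'])
    have hfy : f (d₁ y) = g (φ y) := LinearMap.congr_fun hf y
    simp only [LinearMap.add_apply, LinearMap.comp_apply, Submodule.subtype_apply, ← hy, hfy,
      ← map_add]
    congr 1
    ext
    simp [s, φ, hy]
  · rintro ⟨f, rfl⟩
    exact ⟨f ∘ₗ φ₀, rfl⟩

/-- For a presentation `0 → K → F → X → 0` with `F` projective, `Ext¹(X, M)` is the quotient of
`Hom(K, M)` by the maps that extend to `F`. -/
theorem exists_hom_ker_surjective_ext_one {R : Type u} [CommRing R] (X M : ModuleCat.{u} R)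
    {F : Type*} [AddCommGroup F] [Module R F] [Module.Projective R F]
    (q : F →ₗ[R] X) (hq : Function.Surjective q) :
    ∃ π : (LinearMap.ker q →ₗ[R] M) →ₗ[R]
        ((_root_.Ext R (ModuleCat.{u} R) 1).obj (Opposite.op X)).obj M,
      Function.Surjective π ∧
      ∀ g, π g = 0 ↔ ∃ f : F →ₗ[R] M, f ∘ₗ (LinearMap.ker q).subtype = g := by
  let P := ProjectiveResolution.of X
  let d₂ := P.complex.d 2 1
  let d₁ := P.complex.d 1 0
  have : Module.Projective R (P.complex.X 0) :=
    (IsProjective.iff_projective (R := R) _).2 (P.projective 0)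
  have h₁ : Function.Exact d₂.hom d₁.hom :=
    (ShortComplex.ShortExact.moduleCat_exact_iff_function_exact _).1 (P.exact_succ 0)
  have h₀ : Function.Exact d₁.hom (P.π.f 0).hom :=
    (ShortComplex.ShortExact.moduleCat_exact_iff_function_exact _).1 P.exact₀
  have hε : Function.Surjective (P.π.f 0).hom :=
    (ModuleCat.epi_iff_surjective _).1 inferInstance
  obtain ⟨φ, hφ, hsurj, hker⟩ := exists_lift_to_ker (M := M) d₂.hom d₁.hom (P.π.f 0).hom q
    h₁ h₀ hε hq
  let C := P.complex.linearYonedaObj R M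
  let S := C.sc' 0 1 2
  let e : ((_root_.Ext R (ModuleCat.{u} R) 1).obj (Opposite.op X)).obj M ≅
      S.moduleCatLeftHomologyData.H :=
    P.isoExt 1 M ≪≫ ShortComplex.homologyMapIso (C.isoSc' 0 1 2 (by simp) (by simp)) ≪≫
      S.moduleCatHomologyIso
  let τ : (LinearMap.ker q →ₗ[R] M) →ₗ[R] LinearMap.ker S.g.hom :=
    ((ModuleCat.homLinearEquiv (S := R) (M := P.complex.X 1) (N := M)).symm.toLinearMap ∘ₗ
      LinearMap.lcomp R M φ).codRestrict _ fun g ↦ by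
        have : g ∘ₗ φ ∘ₗ d₂.hom = 0 := by rw [hφ, LinearMap.comp_zero]
        exact ModuleCat.hom_ext this
  have hπ (g) : ((LinearMap.range S.moduleCatToCycles).mkQ ∘ₗ τ) g = 0 ↔
      ∃ f : F →ₗ[R] M, f ∘ₗ (LinearMap.ker q).subtype = g := by
    refine Iff.trans ?_ (hker g)
    rw [LinearMap.comp_apply, Submodule.mkQ_apply, Submodule.Quotient.mk_eq_zero]
    refine ⟨fun ⟨f, hf⟩ ↦ ⟨ModuleCat.Hom.hom (A := P.complex.X 0) (B := M) f, ?_⟩,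
      fun ⟨f, hf⟩ ↦ ⟨ModuleCat.ofHom (X := P.complex.X 0) (Y := M) f, ?_⟩⟩
    · exact congrArg (fun z ↦ ModuleCat.Hom.hom (A := P.complex.X 1) (B := M) z.1) hf
    · exact Subtype.ext (ModuleCat.hom_ext hf)
  have hπ_surj : Function.Surjective ((LinearMap.range S.moduleCatToCycles).mkQ ∘ₗ τ) := by
    intro y
    obtain ⟨⟨h, hh⟩, rfl⟩ := Submodule.mkQ_surjective _ y
    obtain ⟨g, f, hgf⟩ := hsurj (ModuleCat.Hom.hom (A := P.complex.X 1) (B := M) h)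
      (congrArg (ModuleCat.Hom.hom (A := P.complex.X 2) (B := M)) hh)
    refine ⟨g, ?_⟩
    refine Eq.symm ((Submodule.Quotient.eq _).2 ?_)
    refine ⟨ModuleCat.ofHom (X := P.complex.X 0) (Y := M) f, Subtype.ext (ModuleCat.hom_ext ?_)⟩
    change f ∘ₗ d₁.hom = ModuleCat.Hom.hom (A := P.complex.X 1) (B := M) h - g ∘ₗ φ
    rw [← hgf]
    abel
  refine ⟨e.toLinearEquiv.symm.toLinearMap ∘ₗ (LinearMap.range S.moduleCatToCycles).mkQ ∘ₗ τ,
    e.toLinearEquiv.symm.surjective.comp hπ_surj, fun g ↦ ?_⟩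
  rw [← hπ g]
  exact e.toLinearEquiv.symm.map_eq_zero_iff

/-- `Ext¹(R/I, M)` is the quotient of `Hom(I, M)` by the maps `a ↦ a • t` with `t : M`. -/
theorem exists_hom_ideal_surjective_ext_one {R : Type u} [CommRing R] (I : Ideal R)
    (M : ModuleCat.{u} R) :
    ∃ π : (I →ₗ[R] M) →ₗ[R]
        ((_root_.Ext R (ModuleCat.{u} R) 1).obj (Opposite.op (ModuleCat.of R (R ⧸ I)))).obj M,
      Function.Surjective π ∧
      ∀ g, π g = 0 ↔ ∃ t : M, ∀ a : I, g a = (a : R) • t := by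
  obtain ⟨π, hπ, hker⟩ := exists_hom_ker_surjective_ext_one (ModuleCat.of R (R ⧸ I)) M
    I.mkQ I.mkQ_surjective
  let e : I ≃ₗ[R] LinearMap.ker I.mkQ := LinearEquiv.ofEq _ _ I.ker_mkQ.symm
  refine ⟨π ∘ₗ LinearMap.lcomp R M e.symm.toLinearMap, hπ.comp fun g ↦
    ⟨g ∘ₗ e.toLinearMap, by ext; simp⟩, fun g ↦ ?_⟩
  rw [LinearMap.comp_apply, hker]
  refine ⟨fun ⟨f, hf⟩ ↦ ⟨f 1, fun a ↦ ?_⟩, fun ⟨t, ht⟩ ↦ ⟨LinearMap.toSpanSingleton R M t, ?_⟩⟩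
  · have : f a = g a := LinearMap.congr_fun hf (e a)
    rw [← this, ← map_smul, smul_eq_mul, mul_one]
  · ext a
    exact (ht (e.symm a)).symm

theorem isSimpleModule_residueField_hom (R : Type*) [CommRing R] [IsLocalRing R] :
    IsSimpleModule R (ResidueField R →ₗ[R] R ⧸ maximalIdeal R) := by
  let e : ((R ⧸ maximalIdeal R) →ₗ[R] R ⧸ maximalIdeal R) →ₗ[R] R ⧸ maximalIdeal R :=
    LinearMap.applyₗ (Submodule.Quotient.mk 1)
  have he : Function.Bijective e := by
    refine ⟨fun f g hfg ↦ ?_, fun y ↦ ?_⟩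
    · ext
      exact hfg
    · obtain ⟨r, rfl⟩ := Submodule.Quotient.mk_surjective _ y
      refine ⟨r • LinearMap.id, ?_⟩
      change (Submodule.Quotient.mk (r * 1) : R ⧸ maximalIdeal R) = _
      rw [mul_one]
  have : IsSimpleModule R (R ⧸ maximalIdeal R) :=
    isSimpleModule_iff_isCoatom.2 (maximalIdeal.isMaximal R).out
  exact IsSimpleModule.congr (LinearEquiv.ofBijective e he)

theorem isSimpleModule_iff_forall_end_eq_smul {R E : Type*} [CommRing R] [IsLocalRing R]
    [AddCommGroup E] [Module R E] (hreg : ∃ x ∈ maximalIdeal R, x ∈ nonZeroDivisors R)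
    (π : (maximalIdeal R →ₗ[R] maximalIdeal R) →ₗ[R] E) (hπ : Function.Surjective π)
    (hker : ∀ g, π g = 0 ↔ ∃ t : maximalIdeal R, ∀ a : maximalIdeal R, g a = (a : R) • t) :
    IsSimpleModule R E ↔
      ∀ f : maximalIdeal R →ₗ[R] maximalIdeal R, ∃ r : R, ∀ a, f a = r • a := by
  have h_smul (r : R) (hr : r ∈ maximalIdeal R) : r • π LinearMap.id = 0 := by
    rw [← map_smul, hker]
    exact ⟨⟨r, hr⟩, fun a ↦ Subtype.ext (mul_comm r a)⟩
  have h_id : π LinearMap.id ≠ 0 := by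
    rw [Ne, hker]
    rintro ⟨t, ht⟩
    obtain ⟨x, hx, hx'⟩ := hreg
    have hxt : x = x * t.1 := congrArg Subtype.val (ht ⟨x, hx⟩)
    have : t.1 = 1 := (mul_cancel_left_mem_nonZeroDivisors hx').1 (by rw [← hxt, mul_one])
    exact (maximalIdeal.isMaximal R).ne_top ((Ideal.eq_top_iff_one _).2 (this ▸ t.2))
  rw [isSimpleModule_iff_toSpanSingleton_surjective]
  refine ⟨fun ⟨_, h⟩ f ↦ ?_, fun h ↦ ⟨⟨_, _, h_id⟩, fun y hy z ↦ ?_⟩⟩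
  · obtain ⟨r, hr⟩ := h _ h_id (π f)
    rw [LinearMap.toSpanSingleton_apply, ← map_smul, eq_comm, ← sub_eq_zero, ← map_sub,
      hker] at hr
    obtain ⟨t, ht⟩ := hr
    refine ⟨r + t.1, fun a ↦ ?_⟩
    have : f a - r • a = a.1 • t := ht a
    rw [sub_eq_iff_eq_add.1 this, add_smul, add_comm]
    congr 1
    exact Subtype.ext (mul_comm _ _)
  · have h_gen (y) : ∃ r : R, r • π LinearMap.id = y := by
      obtain ⟨f, rfl⟩ := hπ y
      obtain ⟨r, hr⟩ := h f
      exact ⟨r, by rw [← map_smul]; congr 1; ext a; simp [hr a]⟩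
    obtain ⟨r, rfl⟩ := h_gen y
    obtain ⟨s, rfl⟩ := h_gen z
    have hr : IsUnit r := by
      by_contra hr
      exact hy (h_smul r hr)
    obtain ⟨u, hu⟩ := hr.exists_left_inv
    exact ⟨s * u, by simp [smul_smul, mul_assoc, hu]⟩

/-- `𝔪` is Elias if and only if `End(𝔪) = R`. -/
theorem eliasIdeal_maximalIdeal_iff {R : Type u} [CommRing R] [IsLocalRing R]
    (hreg : ∃ x ∈ maximalIdeal R, x ∈ nonZeroDivisors R) :
    EliasIdeal R (maximalIdeal R) ↔
      ∀ f : maximalIdeal R →ₗ[R] maximalIdeal R, ∃ r : R, ∀ a, f a = r • a := by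
  rw [EliasIdeal, quotType, rlength_eq_one_iff.2 (isSimpleModule_residueField_hom R),
    idealType, modType, rlength_eq_one_iff]
  obtain ⟨π, hπ, hker⟩ := exists_hom_ideal_surjective_ext_one (maximalIdeal R)
    (ModuleCat.of R (maximalIdeal R))
  exact isSimpleModule_iff_forall_end_eq_smul hreg π hπ hker

theorem forall_end_eq_smul {R : Type*} [CommRing R] {I : Ideal R} (hI : I.IsPrincipal)
    (f : I →ₗ[R] I) : ∃ r : R, ∀ a, f a = r • a := by
  obtain ⟨t, rfl⟩ := hI
  let t' : Ideal.span {t} := ⟨t, Ideal.mem_span_singleton_self t⟩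
  obtain ⟨r, hr⟩ := Ideal.mem_span_singleton'.1 (f t').2
  refine ⟨r, fun ⟨a, ha⟩ ↦ ?_⟩
  obtain ⟨s, rfl⟩ := Ideal.mem_span_singleton'.1 ha
  have hst : (⟨s * t, ha⟩ : Ideal.span {t}) = s • t' := rfl
  have hft : f t' = r • t' := Subtype.ext hr.symm
  rw [hst, map_smul, hft, smul_comm]

theorem exists_notMem_span_forall_mul_mem_span {R : Type*} [CommRing R] [IsLocalRing R]
    [IsNoetherianRing R] (hdim : ringKrullDim R ≤ 1) {x : R} (hx : x ∈ maximalIdeal R)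
    (hx' : x ∈ nonZeroDivisors R) :
    ∃ y ∉ Ideal.span {x}, ∀ a ∈ maximalIdeal R, a * y ∈ Ideal.span {x} := by
  have : Nontrivial (R ⧸ Ideal.span {x}) :=
    Ideal.Quotient.nontrivial_iff.2 fun h ↦ hx (Ideal.span_singleton_eq_top.1 h)
  have : IsLocalRing (R ⧸ Ideal.span {x}) :=
    .of_surjective' (Ideal.Quotient.mk _) Ideal.Quotient.mk_surjective
  have : Ring.KrullDimLE 0 (R ⧸ Ideal.span {x}) := by
    rw [Ring.krullDimLE_iff]
    have h := (ringKrullDim_quotient_succ_le_of_nonZeroDivisor hx').trans hdim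
    exact (WithBot.add_le_add_iff_right' (WithBot.coe_ne_bot (a := (1 : ℕ∞)))
      (WithBot.coe_injective.ne ENat.one_ne_top)).1 (h.trans (zero_add _).ge)
  obtain ⟨p, hp⟩ := associatedPrimes.nonempty (R ⧸ Ideal.span {x}) (R ⧸ Ideal.span {x})
  obtain ⟨hp, y, hy⟩ := isAssociatedPrime_iff.1 hp
  obtain ⟨y, rfl⟩ := Ideal.Quotient.mk_surjective y
  have hmem (a : R ⧸ Ideal.span {x}) : a ∈ p ↔ a * Ideal.Quotient.mk _ y = 0 := by
    rw [hy, Submodule.mem_colon_singleton, Submodule.mem_bot, smul_eq_mul]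
  refine ⟨y, fun h ↦ ?_, fun a ha ↦ ?_⟩
  · refine hp.ne_top ((Ideal.eq_top_iff_one _).2 ((hmem 1).2 ?_))
    rw [Ideal.Quotient.eq_zero_iff_mem.2 h, mul_zero]
  · rw [← Ideal.Quotient.eq_zero_iff_mem, map_mul, ← hmem,
      Ring.KrullDimLE.eq_maximalIdeal_of_isPrime p]
    have := IsLocalHom.of_surjective (Ideal.Quotient.mk (Ideal.span {x}))
      Ideal.Quotient.mk_surjective
    exact fun h ↦ ha (isUnit_of_map_unit _ _ h)

theorem isPrincipal_of_forall_end_eq_smul {R : Type*} [CommRing R] [IsLocalRing R]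
    [IsNoetherianRing R] (hdim : ringKrullDim R ≤ 1)
    (hreg : ∃ x ∈ maximalIdeal R, x ∈ nonZeroDivisors R)
    (h : ∀ f : maximalIdeal R →ₗ[R] maximalIdeal R, ∃ r : R, ∀ a, f a = r • a) :
    (maximalIdeal R).IsPrincipal := by
  obtain ⟨x, hx, hx'⟩ := hreg
  obtain ⟨y, hy, hmul⟩ := exists_notMem_span_forall_mul_mem_span hdim hx hx'
  choose g hg using fun a : maximalIdeal R ↦ Ideal.mem_span_singleton'.1 (hmul a a.2)
  have hinj {a b : R} (hab : a * x = b * x) : a = b :=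
    (mul_cancel_right_mem_nonZeroDivisors hx').1 hab
  -- `f` is multiplication by the fraction `y / x`
  let f : maximalIdeal R →ₗ[R] R :=
    { toFun := g
      map_add' a b := hinj (by simp only [add_mul, hg, Submodule.coe_add])
      map_smul' r a := hinj (by simp [mul_assoc, hg]) }
  by_cases hf : ∀ a, f a ∈ maximalIdeal R
  · obtain ⟨r, hr⟩ := h (f.codRestrict _ hf)
    have hfx : g ⟨x, hx⟩ = r * x := congrArg Subtype.val (hr ⟨x, hx⟩)
    have hgx := hg ⟨x, hx⟩
    refine absurd (Ideal.mem_span_singleton'.2 ⟨r, hinj ?_⟩) hy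
    rw [← hfx, hgx, mul_comm]
  · push Not at hf
    obtain ⟨b, hb⟩ := hf
    obtain ⟨u, hu⟩ := (notMem_maximalIdeal.1 hb).exists_left_inv
    let t := u • b
    have ht : f t = 1 := by rw [map_smul, smul_eq_mul, hu]
    have hty : x = t * y := by simpa [f, hg] using congrArg (· * x) ht.symm
    refine ⟨t, le_antisymm (fun a ha ↦ ?_) ((Ideal.span_singleton_le_iff_mem _).2 t.2)⟩
    refine Ideal.mem_span_singleton'.2 ⟨g ⟨a, ha⟩, hinj ?_⟩
    rw [mul_right_comm, hg, mul_assoc, mul_comm y, ← hty]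

theorem elias_index_one_iff_regular (R : Type u) [CommRing R] [IsLocalRing R] [IsNoetherianRing R]
    (hdim : ringKrullDim R = 1)
    (hCM : ∃ x ∈ maximalIdeal R, x ∈ nonZeroDivisors R) :
    sInf {s : ℕ | 1 ≤ s ∧ EliasIdeal R ((maximalIdeal R) ^ s)} = 1 ↔
      (maximalIdeal R).IsPrincipal := by
  have h_eq_one : sInf {s : ℕ | 1 ≤ s ∧ EliasIdeal R ((maximalIdeal R) ^ s)} = 1 ↔
      EliasIdeal R ((maximalIdeal R) ^ 1) := by
    refine ⟨fun h ↦ ?_, fun h ↦ le_antisymm (Nat.sInf_le ⟨le_rfl, h⟩) ?_⟩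
    · have := Nat.sInf_mem (Nat.nonempty_of_sInf_eq_succ h)
      rw [h] at this
      exact this.2
    · exact (Nat.sInf_mem (s := {s : ℕ | 1 ≤ s ∧ EliasIdeal R ((maximalIdeal R) ^ s)})
        ⟨1, le_rfl, h⟩).1
  rw [h_eq_one, pow_one, eliasIdeal_maximalIdeal_iff hCM]
  exact ⟨isPrincipal_of_forall_end_eq_smul hdim.le hCM, fun h f ↦ forall_end_eq_smul h f⟩
end

section
/- Let (R, m) be a one-dimensional Gorenstein local ring with multiplicity e(R) ≥ 3 (so eli(R) ≠ 2): the ideal m^2 is not Elias. Equivalently, for a one-dimensional Gorenstein local ring R, eli(R) = 2 if and only if e(R) = 2. -/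
open CategoryTheory IsLocalRing

universe u

/-- A linear map whose values are multiples of a nonzerodivisor `x` can be divided by `x`. -/
lemma exists_linearMap_smul_eq {R P M : Type*} [CommRing R] [AddCommGroup P] [Module R P]
    [AddCommGroup M] [Module R M] {x : R} (hx : ∀ m : M, x • m = 0 → m = 0)
    (f : P →ₗ[R] M) (hf : ∀ p, ∃ m, x • m = f p) : ∃ g : P →ₗ[R] M, ∀ p, x • g p = f p := by
  choose g hg using hf
  have inj : ∀ m m' : M, x • m = x • m' → m = m' := fun m m' h =>
    sub_eq_zero.1 (hx _ (by rw [smul_sub, h, sub_self]))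
  refine ⟨⟨⟨g, fun a b => inj _ _ ?_⟩, fun c a => inj _ _ ?_⟩, hg⟩
  · rw [smul_add, hg, hg, hg, map_add]
  · rw [hg, RingHom.id_apply, smul_comm, hg, map_smul]

/-- If `x` kills `N` and is a nonzerodivisor on `M`, then the first cohomology of `Hom(P, M)` for a
projective resolution `P` of `N` is `Hom(N, M / xM)`. -/
lemma exists_cocycle_hom_surjective {R P₀ P₁ P₂ N M Q : Type*} [CommRing R]
    [AddCommGroup P₀] [Module R P₀] [AddCommGroup P₁] [Module R P₁] [AddCommGroup P₂] [Module R P₂]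
    [AddCommGroup N] [Module R N] [AddCommGroup M] [Module R M] [AddCommGroup Q] [Module R Q]
    [Module.Projective R P₀] {d₂ : P₂ →ₗ[R] P₁} {d₁ : P₁ →ₗ[R] P₀} {π : P₀ →ₗ[R] N}
    (h₂ : Function.Exact d₂ d₁) (h₁ : Function.Exact d₁ π) (hπ : Function.Surjective π)
    {x : R} (hN : ∀ n : N, x • n = 0) (hx : ∀ m : M, x • m = 0 → m = 0)
    {q : M →ₗ[R] Q} (hq : Function.Surjective q) (hqx : ∀ m, q m = 0 ↔ ∃ m', x • m' = m) :
    ∃ Φ : LinearMap.ker (LinearMap.lcomp R M d₂) →ₗ[R] (N →ₗ[R] Q),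
      Function.Surjective Φ ∧ ∀ φ, Φ φ = 0 ↔ ∃ ψ : P₀ →ₗ[R] M, ψ ∘ₗ d₁ = φ.1 := by
  have inj : ∀ m m' : M, x • m = x • m' → m = m' := fun m m' h =>
    sub_eq_zero.1 (hx _ (by rw [smul_sub, h, sub_self]))
  have hφ : ∀ φ : LinearMap.ker (LinearMap.lcomp R M d₂), ∀ w, d₁ w = 0 → φ.1 w = 0 := by
    intro φ w hw
    obtain ⟨v, rfl⟩ := (h₂ w).1 hw
    exact LinearMap.congr_fun (LinearMap.mem_ker.1 φ.2) v
  have hlift : ∀ p, ∃ w, d₁ w = x • p := fun p => (h₁ _).1 (by rw [map_smul, hN])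
  choose s hs using hπ
  choose w hw using hlift
  have key : ∀ φ : LinearMap.ker (LinearMap.lcomp R M d₂), ∀ p v, d₁ v = x • p →
      q (φ.1 (w (s (π p)))) = q (φ.1 v) := by
    intro φ p v hv
    obtain ⟨u, hu⟩ := (h₁ (p - s (π p))).1 (by rw [map_sub, hs, sub_self])
    have h := hφ φ (v - w (s (π p)) - x • u) (by
      rw [map_sub, map_sub, map_smul, hv, hw, hu, smul_sub, sub_self])
    rw [map_sub, map_sub, map_smul, sub_sub, sub_eq_zero] at h
    rw [h, map_add, (hqx _).2 ⟨_, rfl⟩, add_zero]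
  let Φ : LinearMap.ker (LinearMap.lcomp R M d₂) →ₗ[R] (N →ₗ[R] Q) :=
    { toFun := fun φ =>
        { toFun := fun n => q (φ.1 (w (s n)))
          map_add' := fun a b => by
            have := key φ (s a + s b) (w (s a) + w (s b)) (by
              rw [map_add, hw, hw, smul_add])
            rw [map_add, hs, hs] at this
            rw [this, map_add, map_add]
          map_smul' := fun c a => by
            have := key φ (c • s a) (c • w (s a)) (by
              rw [map_smul, hw, smul_comm])
            rw [map_smul, hs] at this
            rw [this, map_smul, map_smul, RingHom.id_apply] }
      map_add' := fun φ ψ => by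
        ext n
        simp
      map_smul' := fun c φ => by
        ext n
        simp }
  have hΦ : ∀ φ p v, d₁ v = x • p → Φ φ (π p) = q (φ.1 v) := key
  refine ⟨Φ, fun θ => ?_, fun φ => ⟨fun h => ?_, fun ⟨ψ, hψ⟩ => ?_⟩⟩
  · obtain ⟨ψ, hψ⟩ := Module.projective_lifting_property q (θ ∘ₗ π) hq
    have hψ' : ∀ p, q (ψ p) = θ (π p) := fun p => LinearMap.congr_fun hψ p
    obtain ⟨φ, hφ'⟩ := exists_linearMap_smul_eq hx (ψ ∘ₗ d₁) fun v => (hqx _).1 (by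
      rw [LinearMap.comp_apply, hψ', h₁.apply_apply_eq_zero, map_zero])
    refine ⟨⟨φ, LinearMap.mem_ker.2 (LinearMap.ext fun v => hx _ ?_)⟩, LinearMap.ext fun n => ?_⟩
    · rw [LinearMap.lcomp_apply, hφ', LinearMap.comp_apply, h₂.apply_apply_eq_zero, map_zero]
    · have h3 : φ (w (s n)) = ψ (s n) := inj _ _ (by
        rw [hφ', LinearMap.comp_apply, hw, map_smul])
      change q (φ (w (s n))) = _
      rw [h3, hψ', hs]
  · obtain ⟨ψ, hψ⟩ := exists_linearMap_smul_eq (P := P₀) hx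
      { toFun := fun p => φ.1 (w p)
        map_add' := fun a b => by
          rw [← map_add, ← sub_eq_zero, ← map_sub]
          exact hφ φ _ (by rw [map_sub, map_add, hw, hw, hw, smul_add, sub_self])
        map_smul' := fun c a => by
          rw [← map_smul, ← sub_eq_zero, ← map_sub]
          exact hφ φ _ (by
            rw [map_sub, map_smul, hw, hw, RingHom.id_apply, smul_comm, sub_self]) }
      fun p => (hqx _).1 (by
        have := hΦ φ p (w p) (hw p)
        rw [h] at this
        exact this.symm)
    refine ⟨ψ, LinearMap.ext fun v => inj _ _ ?_⟩
    rw [LinearMap.comp_apply, hψ, ← map_smul]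
    change φ.1 (w (d₁ v)) = _
    rw [← sub_eq_zero, ← map_sub]
    exact hφ φ _ (by rw [map_sub, hw, map_smul, sub_self])
  · ext n
    change q (φ.1 (w (s n))) = 0
    rw [← hψ, LinearMap.comp_apply, hw, map_smul]
    exact (hqx _).2 ⟨_, rfl⟩

/-- If `x` kills `N` and is a nonzerodivisor on `M`, then `Ext¹(N, M)` has the same length as
`Hom(N, M / xM)`. -/
lemma length_ext_one_eq {R : Type u} [CommRing R] {N M : Type u} {Q : Type*}
    [AddCommGroup N] [Module R N] [AddCommGroup M] [Module R M] [AddCommGroup Q] [Module R Q]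
    {x : R} (hN : ∀ n : N, x • n = 0) (hx : ∀ m : M, x • m = 0 → m = 0)
    {q : M →ₗ[R] Q} (hq : Function.Surjective q) (hqx : ∀ m, q m = 0 ↔ ∃ m', x • m' = m) :
    Module.length R (((_root_.Ext R (ModuleCat.{u} R) 1).obj
      (Opposite.op (ModuleCat.of R N))).obj (ModuleCat.of R M)) =
      Module.length R (N →ₗ[R] Q) := by
  let P := ProjectiveResolution.of (ModuleCat.of R N)
  let S := (P.complex.linearYonedaObj R (ModuleCat.of R M)).sc' 0 1 2
  have e := (P.isoExt (R := R) 1 (ModuleCat.of R M)) ≪≫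
    (P.complex.linearYonedaObj R (ModuleCat.of R M)).homologyIsoSc' 0 1 2 (by simp) (by simp) ≪≫
    S.moduleCatHomologyIso
  let d₂ : P.complex.X 2 →ₗ[R] P.complex.X 1 := (P.complex.d 2 1).hom
  let d₁ : P.complex.X 1 →ₗ[R] P.complex.X 0 := (P.complex.d 1 0).hom
  let π : P.complex.X 0 →ₗ[R] N := (P.π.f 0).hom
  have h₁ : Function.Exact d₁ π :=
    (ShortComplex.ShortExact.moduleCat_exact_iff_function_exact _).1 P.exact₀
  have h₂ : Function.Exact d₂ d₁ :=
    (ShortComplex.ShortExact.moduleCat_exact_iff_function_exact _).1 (P.exact_succ 0)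
  have hπ : Function.Surjective π := (ModuleCat.epi_iff_surjective (P.π.f 0)).1 inferInstance
  obtain ⟨Φ, hΦ, hΦ0⟩ := exists_cocycle_hom_surjective h₂ h₁ hπ hN hx hq hqx
  let F : LinearMap.ker S.g.hom →ₗ[R] LinearMap.ker (LinearMap.lcomp R M d₂) :=
    LinearMap.codRestrict _
      ((ModuleCat.homLinearEquiv (S := R) (M := P.complex.X 1)
        (N := ModuleCat.of R M)).toLinearMap ∘ₗ (LinearMap.ker S.g.hom).subtype)
      fun f => by
        have h : (P.complex.d 2 1 ≫ f.1 : P.complex.X 2 ⟶ ModuleCat.of R M) = 0 :=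
          LinearMap.mem_ker.1 f.2
        exact congrArg ModuleCat.Hom.hom h
  have hFs : Function.Surjective F := fun φ =>
    ⟨⟨ModuleCat.ofHom φ.1, LinearMap.mem_ker.2 (ModuleCat.hom_ext (LinearMap.mem_ker.1 φ.2))⟩,
      rfl⟩
  have hker : LinearMap.ker (Φ ∘ₗ F) = LinearMap.range S.moduleCatToCycles := by
    ext f
    rw [LinearMap.mem_ker, LinearMap.comp_apply, hΦ0]
    constructor
    · rintro ⟨ψ, hψ⟩
      exact ⟨ModuleCat.ofHom ψ, Subtype.ext (ModuleCat.hom_ext hψ)⟩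
    · rintro ⟨ψ, rfl⟩
      let ψ' : P.complex.X 0 ⟶ ModuleCat.of R M := ψ
      exact ⟨ψ'.hom, rfl⟩
  exact (e.toLinearEquiv.trans ((Submodule.quotEquivOfEq _ _ hker.symm).trans
    ((Φ ∘ₗ F).quotKerEquivOfSurjective (hΦ.comp hFs)))).length_eq

lemma rlength_eq_coe_length (R : Type u) (M : Type*) [Ring R] [AddCommGroup M] [Module R M] :
    rlength R M = (Module.length R M : WithBot ℕ∞) :=
  (Module.coe_length R M).symm

lemma smul_residueField_eq_zero {R : Type u} [CommRing R] [IsLocalRing R] {x : R}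
    (hx : x ∈ maximalIdeal R) (n : ResidueField R) : x • n = 0 := by
  rw [Algebra.smul_def, ResidueField.algebraMap_eq, (residue_eq_zero_iff x).2 hx, zero_mul]

lemma exists_residueField_hom {R : Type u} [CommRing R] [IsLocalRing R] {Q : Type*}
    [AddCommGroup Q] [Module R Q] {z : Q} (hz : ∀ a ∈ maximalIdeal R, a • z = 0) :
    ∃ f : ResidueField R →ₗ[R] Q, f 1 = z :=
  ⟨Submodule.liftQ (maximalIdeal R) (LinearMap.toSpanSingleton R Q z) fun a ha => by
    rw [LinearMap.mem_ker, LinearMap.toSpanSingleton_apply, hz a ha],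
    (Submodule.liftQ_apply (maximalIdeal R) _ (1 : R)).trans (one_smul R z)⟩

lemma residueField_hom_ext {R : Type u} [CommRing R] [IsLocalRing R] {Q : Type*}
    [AddCommGroup Q] [Module R Q] {f g : ResidueField R →ₗ[R] Q} (h : f 1 = g 1) : f = g := by
  refine LinearMap.ext fun n => ?_
  obtain ⟨r, rfl⟩ := residue_surjective n
  have : residue R r = r • (1 : ResidueField R) := by
    rw [Algebra.smul_def, mul_one, ResidueField.algebraMap_eq]
  rw [this, map_smul, map_smul, h]

lemma length_residueField_hom_ne_top {R : Type u} [CommRing R] [IsLocalRing R] {Q : Type*}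
    [AddCommGroup Q] [Module R Q] (hQ : Module.length R Q ≠ ⊤) :
    Module.length R (ResidueField R →ₗ[R] Q) ≠ ⊤ :=
  ne_top_of_le_ne_top hQ (Module.length_le_of_injective
    (LinearMap.applyₗ (R := R) (M := ResidueField R) (M₂ := Q) 1)
    fun _ _ h => residueField_hom_ext h)

/-- The socle of `R / x` is one-dimensional when `R` is Gorenstein of dimension one. -/
lemma socle_of_modType_eq_one {R : Type u} [CommRing R] [IsLocalRing R]
    (hGor : modType R (ModuleCat.of R R) = 1) {x : R} (hxm : x ∈ maximalIdeal R)
    (hx : ∀ r, x * r = 0 → r = 0) :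
    (∃ t, (∀ a ∈ maximalIdeal R, x ∣ t * a) ∧ ¬ x ∣ t) ∧
      ∀ u v, (∀ a ∈ maximalIdeal R, x ∣ u * a) → (∀ a ∈ maximalIdeal R, x ∣ v * a) →
        ¬ x ∣ u → ∃ c, x ∣ v - c * u := by
  have hq : ∀ r : R, (Ideal.span {x}).mkQ r = 0 ↔ x ∣ r := fun r => by
    rw [Submodule.mkQ_apply, Submodule.Quotient.mk_eq_zero, Ideal.mem_span_singleton]
  have hlen : Module.length R (ResidueField R →ₗ[R] R ⧸ Ideal.span {x}) = 1 := by
    rw [← length_ext_one_eq (smul_residueField_eq_zero hxm) hx (Submodule.mkQ_surjective _)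
      (fun r => by rw [hq]; exact ⟨fun ⟨c, hc⟩ => ⟨c, hc.symm⟩, fun ⟨c, hc⟩ => ⟨c, hc.symm⟩⟩)]
    rw [modType, rlength_eq_coe_length] at hGor
    exact_mod_cast hGor
  have hs := Module.length_eq_one_iff.1 hlen
  have hhom : ∀ u, (∀ a ∈ maximalIdeal R, x ∣ u * a) →
      ∃ f : ResidueField R →ₗ[R] R ⧸ Ideal.span {x}, f 1 = (Ideal.span {x}).mkQ u := by
    refine fun u hu => exists_residueField_hom fun a ha => ?_
    rw [← map_smul, hq, smul_eq_mul, mul_comm]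
    exact hu a ha
  constructor
  · have := hs.nontrivial
    obtain ⟨f, hf⟩ := exists_ne (0 : ResidueField R →ₗ[R] R ⧸ Ideal.span {x})
    obtain ⟨t, ht⟩ := Submodule.mkQ_surjective (Ideal.span {x}) (f 1)
    refine ⟨t, fun a ha => ?_, fun h => hf (residueField_hom_ext ?_)⟩
    · rw [← hq, mul_comm, ← smul_eq_mul, map_smul, ht, ← map_smul,
        smul_residueField_eq_zero ha, map_zero]
    · rw [← ht, (hq t).2 h, LinearMap.zero_apply]
  · intro u v hu hv hxu
    obtain ⟨f, hf⟩ := hhom u hu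
    obtain ⟨g, hg⟩ := hhom v hv
    have hf0 : f ≠ 0 := by
      rintro rfl
      exact hxu ((hq u).1 (hf.symm.trans (LinearMap.zero_apply _)))
    obtain ⟨c, hc⟩ := IsSimpleModule.toSpanSingleton_surjective R hf0 g
    refine ⟨c, (hq _).1 ?_⟩
    rw [map_sub, ← smul_eq_mul, map_smul, ← hf, ← hg, ← hc]
    simp

/-- An ideal `I` containing a nonzerodivisor `x` is Elias iff `xI : m` is contained in `(x)`. -/
lemma eliasIdeal_iff {R : Type u} [CommRing R] [IsLocalRing R] {I : Ideal R}
    (hI : I ≤ maximalIdeal R) (hfin : Module.length R (R ⧸ I) ≠ ⊤) {x : R} (hxI : x ∈ I)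
    (hx : ∀ r, x * r = 0 → r = 0) :
    EliasIdeal R I ↔ ∀ r, (∀ a ∈ maximalIdeal R, ∃ i ∈ I, r * a = x * i) → x ∣ r := by
  have hcancel : ∀ r s, x * r = x * s → r = s := fun r s h =>
    sub_eq_zero.1 (hx _ (by rw [mul_sub, h, sub_self]))
  let N : Submodule R I := LinearMap.range (LinearMap.lsmul R I x)
  have hN : ∀ i : I, N.mkQ i = 0 ↔ ∃ j : I, x • j = i := fun i => by
    rw [Submodule.mkQ_apply, Submodule.Quotient.mk_eq_zero]
    exact Iff.rfl
  have hq : ∀ r : R, (Ideal.span {x}).mkQ r = 0 ↔ x ∣ r := fun r => by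
    rw [Submodule.mkQ_apply, Submodule.Quotient.mk_eq_zero, Ideal.mem_span_singleton]
  let f : (R ⧸ I) →ₗ[R] (I ⧸ N) :=
    I.liftQ (N.mkQ ∘ₗ LinearMap.toSpanSingleton R I ⟨x, hxI⟩) fun i hi => by
      rw [LinearMap.mem_ker, LinearMap.comp_apply, hN]
      exact ⟨⟨i, hi⟩, Subtype.ext (mul_comm x i)⟩
  let g : (I ⧸ N) →ₗ[R] (R ⧸ Ideal.span {x}) :=
    N.liftQ ((Ideal.span {x}).mkQ ∘ₗ I.subtype) (by
      rintro _ ⟨i, rfl⟩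
      rw [LinearMap.mem_ker, LinearMap.comp_apply, hq]
      exact ⟨i.1, rfl⟩)
  have hfr : ∀ r : R, f (I.mkQ r) = N.mkQ (r • ⟨x, hxI⟩) := fun r => rfl
  have hgi : ∀ i : I, g (N.mkQ i) = (Ideal.span {x}).mkQ i.1 := fun i => rfl
  have hf : Function.Injective f := by
    rw [injective_iff_map_eq_zero]
    intro z hz
    obtain ⟨r, rfl⟩ := Submodule.mkQ_surjective I z
    rw [hfr, hN] at hz
    obtain ⟨j, hj⟩ := hz
    have : x * j.1 = r * x := congrArg Subtype.val hj
    rw [mul_comm r] at this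
    rw [← hcancel _ _ this, Submodule.mkQ_apply, Submodule.Quotient.mk_eq_zero]
    exact j.2
  have hfg : ∀ z, g z = 0 → ∃ w, f w = z := by
    intro z hz
    obtain ⟨i, rfl⟩ := Submodule.mkQ_surjective N z
    rw [hgi, hq] at hz
    obtain ⟨r, hr⟩ := hz
    exact ⟨I.mkQ r, by rw [hfr]; exact congrArg _ (Subtype.ext (by rw [hr, mul_comm]; rfl))⟩
  have hgf : ∀ w, g (f w) = 0 := by
    intro w
    obtain ⟨r, rfl⟩ := Submodule.mkQ_surjective I w
    rw [hfr, hgi, hq]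
    exact ⟨r, mul_comm r x⟩
  let F := f.compRight (M := ResidueField R) R
  have hlen := Module.length_eq_add_of_exact F (LinearMap.range F).mkQ
    (fun a b h => LinearMap.ext fun n => hf (LinearMap.congr_fun h n))
    (Submodule.mkQ_surjective _) (LinearMap.exact_map_mkQ_range F)
  have hE : EliasIdeal R I ↔ Module.length R (_ ⧸ LinearMap.range F) = 0 := by
    rw [EliasIdeal, idealType, quotType, modType, rlength_eq_coe_length, rlength_eq_coe_length,
      length_ext_one_eq (smul_residueField_eq_zero (hI hxI))
        (fun m hm => Subtype.ext (hx m.1 (congrArg Subtype.val hm)))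
        (Submodule.mkQ_surjective N) hN, hlen, WithBot.coe_inj]
    have h := length_residueField_hom_ne_top hfin
    constructor
    · intro h'
      exact ENat.add_right_injective_of_ne_top h (h'.trans (add_zero _).symm)
    · intro h'
      rw [h', add_zero]
  rw [hE, Module.length_eq_zero_iff, Submodule.Quotient.subsingleton_iff,
    LinearMap.range_eq_top]
  constructor
  · intro hF r hr
    have hrI : r ∈ I := by
      obtain ⟨i, hi, h⟩ := hr x (hI hxI)
      rwa [hcancel r i ((mul_comm x r).trans h)]
    obtain ⟨φ, hφ⟩ := exists_residueField_hom (R := R) (z := N.mkQ ⟨r, hrI⟩) fun a ha => by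
      obtain ⟨i, hi, h⟩ := hr a ha
      rw [← map_smul, hN]
      exact ⟨⟨i, hi⟩, Subtype.ext (h.symm.trans (mul_comm r a))⟩
    obtain ⟨ψ, rfl⟩ := hF φ
    rw [← hq]
    change g (N.mkQ ⟨r, hrI⟩) = 0
    rw [← hφ]
    exact hgf (ψ 1)
  · intro h φ
    have hg : g (φ 1) = 0 := by
      obtain ⟨i, hi⟩ := Submodule.mkQ_surjective N (φ 1)
      rw [← hi, hgi, hq]
      refine h _ fun a ha => ?_
      have : N.mkQ (a • i) = 0 := by
        rw [map_smul, hi, ← map_smul, smul_residueField_eq_zero ha, map_zero]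
      obtain ⟨j, hj⟩ := (hN _).1 this
      exact ⟨j, j.2, ((congrArg Subtype.val hj).trans (mul_comm a i.1)).symm⟩
    obtain ⟨w, hw⟩ := hfg _ hg
    obtain ⟨ψ, hψ⟩ := exists_residueField_hom (R := R) (z := w) fun a ha => hf (by
      rw [map_smul, hw, ← map_smul, smul_residueField_eq_zero ha, map_zero, map_zero])
    exact ⟨ψ, residueField_hom_ext ((congrArg f hψ).trans hw)⟩

/-- The length of `R / J`, as a natural number (zero if the length is infinite). -/
noncomputable def colen {R : Type*} [CommRing R] (J : Ideal R) : ℕ :=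
  (Module.length R (R ⧸ J)).toNat

/-- `R / J` has finite length. -/
def FinColen {R : Type*} [CommRing R] (J : Ideal R) : Prop :=
  Module.length R (R ⧸ J) ≠ ⊤

/-- The ideal `(x) : J`. -/
def colonSpan {R : Type*} [CommRing R] (x : R) (J : Ideal R) : Ideal R where
  carrier := {r | ∀ j ∈ J, x ∣ r * j}
  add_mem' ha hb j hj := by rw [add_mul]; exact dvd_add (ha j hj) (hb j hj)
  zero_mem' j _ := by rw [zero_mul]; exact dvd_zero x
  smul_mem' c r hr j hj := by rw [smul_eq_mul, mul_assoc]; exact (hr j hj).mul_left c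

section Colength

variable {R : Type*} [CommRing R]

lemma FinColen.mono {J J' : Ideal R} (h : J ≤ J') (hJ : FinColen J) : FinColen J' :=
  ne_top_of_le_ne_top hJ (Module.length_le_of_surjective _ (Submodule.factor_surjective h))

lemma coe_colen {J : Ideal R} (hJ : FinColen J) : (colen J : ℕ∞) = Module.length R (R ⧸ J) :=
  ENat.natCast_toNat hJ

lemma length_quotient_eq_add {J J' : Ideal R} (h : J ≤ J') : Module.length R (R ⧸ J) =
    Module.length R (LinearMap.ker (Submodule.factor h)) + Module.length R (R ⧸ J') :=
  Module.length_eq_add_of_exact (LinearMap.ker (Submodule.factor h)).subtype _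
    (Submodule.subtype_injective _) (Submodule.factor_surjective h)
    (LinearMap.exact_subtype_ker_map _)

lemma colen_top : colen (⊤ : Ideal R) = 0 := by
  have : Subsingleton (R ⧸ (⊤ : Ideal R)) := Submodule.Quotient.subsingleton_iff.2 rfl
  rw [colen, Module.length_eq_zero, ENat.toNat_zero]

lemma colen_add_one_le {J J' : Ideal R} (h : J < J') (hJ : FinColen J) :
    colen J' + 1 ≤ colen J := by
  have hJ' := hJ.mono h.le
  have hpos : 1 ≤ Module.length R (LinearMap.ker (Submodule.factor h.le)) := by
    obtain ⟨z, hz, hz'⟩ := SetLike.exists_of_lt h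
    rw [Order.one_le_iff_ne_zero, ne_eq, Module.length_eq_zero_iff]
    intro hs
    have hk : Submodule.factor h.le (J.mkQ z) = 0 :=
      (Submodule.Quotient.mk_eq_zero J').2 hz
    have := congrArg Subtype.val (Subsingleton.elim (⟨J.mkQ z, hk⟩ : LinearMap.ker _) 0)
    exact hz' ((Submodule.Quotient.mk_eq_zero J).1 this)
  have := length_quotient_eq_add h.le
  rw [← coe_colen hJ, ← coe_colen hJ'] at this
  have h2 : (colen J' : ℕ∞) + 1 ≤ colen J := by
    rw [this, add_comm]
    gcongr
  exact_mod_cast h2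

lemma colen_anti {J J' : Ideal R} (h : J ≤ J') (hJ : FinColen J) : colen J' ≤ colen J := by
  rcases h.eq_or_lt with rfl | h
  · exact le_rfl
  · exact (Nat.le_succ _).trans (colen_add_one_le h hJ)

lemma eq_of_colen_le {J J' : Ideal R} (h : J ≤ J') (hJ : FinColen J)
    (hle : colen J ≤ colen J') : J = J' := by
  by_contra hne
  have := colen_add_one_le (lt_of_le_of_ne h hne) hJ
  omega

lemma colen_le_add_one [IsLocalRing R] {J J' : Ideal R} (hJ : FinColen J) (h : J ≤ J') {w : R}
    (hw : ∀ a ∈ maximalIdeal R, a * w ∈ J) (hJ' : ∀ r ∈ J', ∃ c, r - c * w ∈ J) :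
    colen J ≤ colen J' + 1 := by
  by_cases hwJ : w ∈ J'
  · have hle : Module.length R (LinearMap.ker (Submodule.factor h)) ≤ 1 := by
      have hs : IsSimpleModule R (R ⧸ maximalIdeal R) :=
        isSimpleModule_iff_isCoatom.2 (maximalIdeal.isMaximal R).out
      rw [← Module.length_eq_one R (R ⧸ maximalIdeal R)]
      let f : (R ⧸ maximalIdeal R) →ₗ[R] LinearMap.ker (Submodule.factor h) :=
        (maximalIdeal R).liftQ (LinearMap.toSpanSingleton R _
          ⟨J.mkQ w, (Submodule.Quotient.mk_eq_zero J').2 hwJ⟩) fun a ha =>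
            Subtype.ext ((Submodule.Quotient.mk_eq_zero J).2 (hw a ha))
      refine Module.length_le_of_surjective f ?_
      rintro ⟨z, hz⟩
      obtain ⟨r, rfl⟩ := Submodule.mkQ_surjective J z
      obtain ⟨c, hc⟩ := hJ' r ((Submodule.Quotient.mk_eq_zero J').1 hz)
      exact ⟨(maximalIdeal R).mkQ c, Subtype.ext ((Submodule.Quotient.eq J).2 hc).symm⟩
    have := length_quotient_eq_add h
    rw [← coe_colen hJ, ← coe_colen (hJ.mono h)] at this
    have h2 : (colen J : ℕ∞) ≤ colen J' + 1 := by
      rw [this, add_comm]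
      gcongr
    exact_mod_cast h2
  · have : J' = J := by
      refine le_antisymm (fun r hr => ?_) h
      obtain ⟨c, hc⟩ := hJ' r hr
      by_cases hu : IsUnit c
      · obtain ⟨u, rfl⟩ := hu
        refine absurd ?_ hwJ
        have := J'.mul_mem_left (↑u⁻¹ : R) (J'.sub_mem hr (h hc))
        simpa using this
      · simpa using J.add_mem hc (hw c ((mem_maximalIdeal c).2 hu))
    rw [this]
    exact Nat.le_succ _

lemma colen_span_mul {y : R} (hy : ∀ r, y * r = 0 → r = 0) {J : Ideal R} (hJ : FinColen J)
    (hyJ : FinColen (Ideal.span {y})) :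
    colen (Ideal.span {y} * J) = colen (Ideal.span {y}) + colen J := by
  let f : (R ⧸ J) →ₗ[R] (R ⧸ Ideal.span {y} * J) :=
    J.liftQ ((Ideal.span {y} * J).mkQ ∘ₗ LinearMap.mul R R y) fun j hj =>
      (Submodule.Quotient.mk_eq_zero _).2
        (Ideal.mul_mem_mul (Ideal.mem_span_singleton_self y) hj)
  have hf : Function.Injective f := by
    rw [injective_iff_map_eq_zero]
    intro z hz
    obtain ⟨r, rfl⟩ := Submodule.mkQ_surjective J z
    obtain ⟨j, hj, hjr⟩ := Ideal.mem_span_singleton_mul.1 ((Submodule.Quotient.mk_eq_zero _).1 hz)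
    have : j = r := sub_eq_zero.1 (hy _ (by rw [mul_sub, hjr]; exact sub_self _))
    exact (Submodule.Quotient.mk_eq_zero _).2 (this ▸ hj)
  have hexact : Function.Exact f (Submodule.factor (Ideal.mul_le_left (I := Ideal.span {y})
      (J := J))) := by
    intro z
    obtain ⟨r, rfl⟩ := Submodule.mkQ_surjective _ z
    constructor
    · intro hz
      obtain ⟨s, rfl⟩ := Ideal.mem_span_singleton.1 ((Submodule.Quotient.mk_eq_zero _).1 hz)
      exact ⟨J.mkQ s, rfl⟩
    · rintro ⟨w, hw⟩
      obtain ⟨s, rfl⟩ := Submodule.mkQ_surjective J w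
      rw [← hw]
      exact (Submodule.Quotient.mk_eq_zero _).2 (Ideal.mem_span_singleton.2 ⟨s, rfl⟩)
  rw [colen, Module.length_eq_add_of_exact f _ hf (Submodule.factor_surjective _) hexact,
    ENat.toNat_add hJ hyJ, add_comm]
  rfl

end Colength

section Duality

variable {R : Type*} [CommRing R] [IsLocalRing R]

lemma exists_mem_socle {J J' : Ideal R} (h : J < J') (hJ : FinColen J) :
    ∃ z ∈ J', z ∉ J ∧ ∀ a ∈ maximalIdeal R, a * z ∈ J := by
  let S : Set R := {z | z ∈ J' ∧ z ∉ J}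
  have hS : S.Nonempty := SetLike.exists_of_lt h
  let f : R → ℕ := fun z => colen J - colen (J ⊔ Ideal.span {z})
  have hwf : WellFounded (Function.onFun (· < ·) f) := (measure f).wf
  refine ⟨hwf.min S hS, (hwf.min_mem S hS).1, (hwf.min_mem S hS).2, fun a ha => ?_⟩
  set z := hwf.min S hS with hz
  have hzS : z ∈ S := hwf.min_mem S hS
  by_contra hazJ
  have hmin : ¬ f (a * z) < f z := hwf.not_lt_min S ⟨J'.mul_mem_left a hzS.1, hazJ⟩
  have hle : J ⊔ Ideal.span {a * z} ≤ J ⊔ Ideal.span {z} :=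
    sup_le_sup_left (Ideal.span_singleton_le_span_singleton.2 (Dvd.intro_left a rfl)) J
  have hfin : FinColen (J ⊔ Ideal.span {a * z}) := hJ.mono le_sup_left
  have h1 := colen_anti (le_sup_left : J ≤ J ⊔ Ideal.span {a * z}) hJ
  have h2 := colen_anti hle hfin
  have heq := eq_of_colen_le hle hfin (by simp only [f] at hmin; omega)
  have hzmem : z ∈ J ⊔ Ideal.span {a * z} :=
    heq ▸ Ideal.mem_sup_right (Ideal.mem_span_singleton_self z)
  obtain ⟨j, hj, w, hw, hjw⟩ := Submodule.mem_sup.1 hzmem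
  obtain ⟨c, rfl⟩ := Ideal.mem_span_singleton.1 hw
  have hu : IsUnit (1 - c * a) := (isUnit_or_isUnit_one_sub_self (c * a)).resolve_left fun hu =>
    (mem_maximalIdeal _).1 ((maximalIdeal R).mul_mem_left c ha) hu
  obtain ⟨u, hu⟩ := hu
  have h3 : z = ↑u⁻¹ * j := by
    have : (u : R) * z = j := by rw [hu]; linear_combination -hjw
    rw [← this, Units.inv_mul_cancel_left]
  exact hzS.2 (h3 ▸ J.mul_mem_left _ hj)

/-- If the socle of `R / x` is one-dimensional, then `J ↦ ℓ(R / (x : J)) + ℓ(R / J)` is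
antitone on ideals containing `x`. -/
lemma colen_colonSpan_add_colen_anti {x : R} (hfin : FinColen (Ideal.span {x}))
    (hsoc : ∀ u v, (∀ a ∈ maximalIdeal R, x ∣ u * a) → (∀ a ∈ maximalIdeal R, x ∣ v * a) →
      ¬ x ∣ u → ∃ c, x ∣ v - c * u)
    {J J' : Ideal R} (hxJ : x ∈ J) (h : J ≤ J') :
    colen (colonSpan x J') + colen J' ≤ colen (colonSpan x J) + colen J := by
  induction hn : colen J using Nat.strong_induction_on generalizing J with
  | _ n ih =>
  subst hn
  rcases h.eq_or_lt with rfl | hlt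
  · exact le_rfl
  have hspan : ∀ {K : Ideal R}, Ideal.span {x} ≤ colonSpan x K := fun {K} =>
    (Ideal.span_singleton_le_iff_mem _).2 fun j _ => dvd_mul_right x j
  have hJ : FinColen J := hfin.mono ((Ideal.span_singleton_le_iff_mem _).2 hxJ)
  obtain ⟨z, hzJ', hzJ, hz⟩ := exists_mem_socle hlt hJ
  let K := J ⊔ Ideal.span {z}
  have hzK : z ∈ K := Ideal.mem_sup_right (Ideal.mem_span_singleton_self z)
  have hJK : J < K := lt_of_le_of_ne le_sup_left fun h => hzJ (h ▸ hzK)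
  have h1 := colen_add_one_le hJK hJ
  have h2 : colen (colonSpan x J') + colen J' ≤ colen (colonSpan x K) + colen K :=
    ih (colen K) h1 (le_sup_left (a := J) hxJ)
    (sup_le h ((Ideal.span_singleton_le_iff_mem _).2 hzJ')) rfl
  have hmemK : ∀ r, r ∈ colonSpan x J → x ∣ r * z → r ∈ colonSpan x K := by
    intro r hr hrz k hk
    obtain ⟨j, hj, w, hw, rfl⟩ := Submodule.mem_sup.1 hk
    obtain ⟨c, rfl⟩ := Ideal.mem_span_singleton.1 hw
    rw [mul_add, ← mul_assoc]
    exact dvd_add (hr j hj) (hrz.mul_right c)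
  have hle : colonSpan x K ≤ colonSpan x J := fun r hr j hj => hr j (hJK.le hj)
  have hzsoc : ∀ r ∈ colonSpan x J, ∀ a ∈ maximalIdeal R, x ∣ r * z * a := fun r hr a ha => by
    rw [mul_assoc, mul_comm z]
    exact hr _ (hz a ha)
  have h3 : colen (colonSpan x K) ≤ colen (colonSpan x J) + 1 := by
    by_cases hw : ∃ w ∈ colonSpan x J, ¬ x ∣ w * z
    · obtain ⟨w, hw, hwz⟩ := hw
      refine colen_le_add_one (hfin.mono hspan) hle (w := w) (fun a ha => ?_) fun r hr => ?_
      · refine hmemK _ (Ideal.mul_mem_left _ a hw) ?_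
        rw [mul_assoc, mul_comm]
        exact hzsoc w hw a ha
      · obtain ⟨c, hc⟩ := hsoc (w * z) (r * z) (hzsoc w hw) (hzsoc r hr) hwz
        exact ⟨c, hmemK _ (Ideal.sub_mem _ hr (Ideal.mul_mem_left _ c hw)) (by
          rw [sub_mul, mul_assoc c]; exact hc)⟩
    · push Not at hw
      have : colonSpan x K = colonSpan x J := le_antisymm hle fun r hr => hmemK r hr (hw r hr)
      exact this ▸ Nat.le_succ _
  omega

/-- If the socle of `R / x` is one-dimensional, then every ideal containing `x` is its own
double annihilator modulo `x`. -/
lemma colonSpan_colonSpan {x : R} (hfin : FinColen (Ideal.span {x}))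
    (hsoc : ∀ u v, (∀ a ∈ maximalIdeal R, x ∣ u * a) → (∀ a ∈ maximalIdeal R, x ∣ v * a) →
      ¬ x ∣ u → ∃ c, x ∣ v - c * u)
    {J : Ideal R} (hxJ : x ∈ J) : colonSpan x (colonSpan x J) = J := by
  have hxC : ∀ K : Ideal R, x ∈ colonSpan x K := fun K j _ => dvd_mul_right x j
  have hspan : ∀ {K : Ideal R}, x ∈ K → Ideal.span {x} ≤ K := fun h =>
    (Ideal.span_singleton_le_iff_mem _).2 h
  have htop : colonSpan x ⊤ = Ideal.span {x} := by
    ext r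
    rw [Ideal.mem_span_singleton]
    exact ⟨fun h => by simpa using h 1 trivial, fun h j _ => h.mul_right j⟩
  have hx : colonSpan x (Ideal.span {x}) = ⊤ := by
    rw [Ideal.eq_top_iff_one]
    intro j hj
    rw [one_mul]
    exact Ideal.mem_span_singleton.1 hj
  have key : ∀ K : Ideal R, x ∈ K →
      colen (colonSpan x K) + colen K = colen (Ideal.span {x}) := by
    intro K hK
    have h1 := colen_colonSpan_add_colen_anti hfin hsoc hK le_top
    have h2 := colen_colonSpan_add_colen_anti hfin hsoc (Ideal.mem_span_singleton_self x) (hspan hK)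
    rw [htop, colen_top] at h1
    rw [hx, colen_top] at h2
    omega
  have hle : J ≤ colonSpan x (colonSpan x J) := fun j hj r hr => by
    rw [mul_comm]
    exact hr j hj
  have h1 := key J hxJ
  have h2 := key (colonSpan x J) (hxC J)
  exact (eq_of_colen_le hle (hfin.mono (hspan hxJ)) (by omega)).symm

end Duality

section Lines

variable {R : Type*} [CommRing R] {L T : Ideal R}

lemma exists_sub_mul_mem_of_chain (hchain : ∀ K K' : Ideal R, L ≤ K → K < K' → K' < T → K = L)
    {A : Ideal R} (hLA : L ≤ A) (hAT : A < T) {p : R} (hp : p ∈ A) (hpL : p ∉ L) :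
    ∀ z ∈ A, ∃ c, z - c * p ∈ L := by
  intro z hz
  have hpm : p ∈ L ⊔ Ideal.span {p} := Ideal.mem_sup_right (Ideal.mem_span_singleton_self p)
  have hle : L ⊔ Ideal.span {p} ≤ A := sup_le hLA ((Ideal.span_singleton_le_iff_mem _).2 hp)
  have heq : L ⊔ Ideal.span {p} = A := by
    by_contra hne
    exact hpL (hchain _ _ le_sup_left (lt_of_le_of_ne hle hne) hAT ▸ hpm)
  rw [← heq] at hz
  obtain ⟨l, hl, w, hw, rfl⟩ := Submodule.mem_sup.1 hz
  obtain ⟨c, rfl⟩ := Ideal.mem_span_singleton.1 hw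
  exact ⟨c, by rwa [mul_comm c, add_sub_cancel_right]⟩

lemma le_of_chain_of_mem (hchain : ∀ K K' : Ideal R, L ≤ K → K < K' → K' < T → K = L)
    {A B : Ideal R} (hLA : L ≤ A) (hAT : A < T) (hLB : L ≤ B) {p : R} (hp : p ∈ A) (hpB : p ∈ B)
    (hpL : p ∉ L) : A ≤ B := by
  intro z hz
  obtain ⟨c, hc⟩ := exists_sub_mul_mem_of_chain hchain hLA hAT hp hpL z hz
  simpa using B.add_mem (hLB hc) (B.mul_mem_left c hpB)

/-- An endomorphism `t / x` of a two-dimensional space `T / L` with three invariant lines is a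
scalar. -/
lemma exists_scalar_of_invariant_lines [IsLocalRing R] {x t : R} (hx : ∀ r, x * r = 0 → r = 0)
    (hchain : ∀ K K' : Ideal R, L ≤ K → K < K' → K' < T → K = L)
    (hmT : ∀ a ∈ maximalIdeal R, ∀ z ∈ T, a * z ∈ L) {A B C : Ideal R}
    (htL : ∀ z ∈ L, ∃ z' ∈ L, t * z = x * z') (htA : ∀ z ∈ A, ∃ z' ∈ A, t * z = x * z')
    (htB : ∀ z ∈ B, ∃ z' ∈ B, t * z = x * z') (htC : ∀ z ∈ C, ∃ z' ∈ C, t * z = x * z')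
    (hLA : L ≤ A) (hAT : A < T) (hLB : L ≤ B) (hBT : B < T) (hLC : L ≤ C) (hCT : C < T)
    (hAB : ¬ A ≤ B) (hBA : ¬ B ≤ A) {p q : R} (hpA : p ∈ A) (hqB : q ∈ B) (hpL : p ∉ L)
    (hqL : q ∉ L) (hpqC : p + q ∈ C) (hpqL : p + q ∉ L) :
    ∃ ν, ∀ z ∈ T, ∃ l ∈ L, (t - ν * x) * z = x * l := by
  have hcancel : ∀ r s, x * r = x * s → r = s := fun r s h =>
    sub_eq_zero.1 (hx _ (by rw [mul_sub, h, sub_self]))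
  have hlA := exists_sub_mul_mem_of_chain hchain hLA hAT hpA hpL
  have hlB := exists_sub_mul_mem_of_chain hchain hLB hBT hqB hqL
  obtain ⟨p', hp', hpp'⟩ := htA p hpA
  obtain ⟨q', hq', hqq'⟩ := htB q hqB
  obtain ⟨s', hs', hss'⟩ := htC _ hpqC
  obtain ⟨α, hα⟩ := hlA p' hp'
  obtain ⟨β, hβ⟩ := hlB q' hq'
  obtain ⟨ν, hν⟩ := exists_sub_mul_mem_of_chain hchain hLC hCT hpqC hpqL s' hs'
  have hsum : s' = p' + q' := hcancel _ _ (by rw [← hss', mul_add, mul_add, hpp', hqq'])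
  have hrel : (α - ν) * p + (β - ν) * q ∈ L := by
    have := L.sub_mem hν (L.add_mem hα hβ)
    rw [hsum] at this
    convert this using 1
    ring
  have hα' : α - ν ∈ maximalIdeal R := by
    by_contra hu
    obtain ⟨u, hu⟩ := not_not.1 (mt (mem_maximalIdeal _).2 hu)
    refine hAB (le_of_chain_of_mem hchain hLA hAT hLB hpA ?_ hpL)
    have h1 := B.sub_mem (hLB hrel) (B.mul_mem_left (β - ν) hqB)
    rw [add_sub_cancel_right, ← hu] at h1
    simpa using B.mul_mem_left (↑u⁻¹ : R) h1
  have hβ' : β - ν ∈ maximalIdeal R := by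
    by_contra hu
    obtain ⟨u, hu⟩ := not_not.1 (mt (mem_maximalIdeal _).2 hu)
    refine hBA (le_of_chain_of_mem hchain hLB hBT hLA hqB ?_ hqL)
    have h1 := A.sub_mem (hLA hrel) (A.mul_mem_left (α - ν) hpA)
    rw [add_sub_cancel_left, ← hu] at h1
    simpa using A.mul_mem_left (↑u⁻¹ : R) h1
  have hT : A ⊔ B = T := by
    by_contra hne
    have hlt : A < A ⊔ B := lt_of_le_of_ne le_sup_left fun h => hBA (h ▸ le_sup_right)
    have := hchain _ _ hLA hlt (lt_of_le_of_ne (sup_le hAT.le hBT.le) hne)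
    exact hpL (this ▸ hpA)
  have scal : ∀ {y y' γ : R}, y ∈ T → t * y = x * y' → y' - γ * y ∈ L →
      γ - ν ∈ maximalIdeal R → ∃ l ∈ L, (t - ν * x) * y = x * l := by
    intro y y' γ hy hyy' hγ hγν
    refine ⟨y' - ν * y, ?_, by linear_combination hyy'⟩
    have := L.add_mem hγ (hmT _ hγν y hy)
    convert this using 1
    ring
  obtain ⟨lp, hlp, hlp'⟩ := scal (hAT.le hpA) hpp' hα hα'
  obtain ⟨lq, hlq, hlq'⟩ := scal (hBT.le hqB) hqq' hβ hβ'
  refine ⟨ν, fun z hz => ?_⟩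
  rw [← hT] at hz
  obtain ⟨a, ha, b, hb, rfl⟩ := Submodule.mem_sup.1 hz
  obtain ⟨c, hc⟩ := hlA a ha
  obtain ⟨d, hd⟩ := hlB b hb
  obtain ⟨e, he, hee⟩ := htL _ (L.add_mem hc hd)
  refine ⟨e - ν * ((a - c * p) + (b - d * q)) + c * lp + d * lq, ?_, ?_⟩
  · exact L.add_mem (L.add_mem (L.sub_mem he (L.mul_mem_left ν (L.add_mem hc hd)))
      (L.mul_mem_left c hlp)) (L.mul_mem_left d hlq)
  · linear_combination hee + c * hlp' + d * hlq'

end Lines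

section Generators

variable {R : Type u} [CommRing R]

lemma lt_sup_span_singleton {J : Ideal R} {v : R} (hv : v ∉ J) : J < J ⊔ Ideal.span {v} :=
  lt_of_le_of_ne le_sup_left fun h =>
    hv (h ▸ Ideal.mem_sup_right (Ideal.mem_span_singleton_self v))

lemma finColen_span_singleton [IsNoetherianRing R] (hdim : ringKrullDim R = 1) {x : R}
    (hx : ∀ r, x * r = 0 → r = 0) : FinColen (Ideal.span {x}) := by
  have : Ring.KrullDimLE 1 R := Ring.krullDimLE_iff.2 hdim.le
  refine Module.length_ne_top_iff.2 (isFiniteLength_quotient_span_singleton R ?_)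
  exact mem_nonZeroDivisors_iff.2 ⟨hx, fun r hr => hx r (by rw [mul_comm, hr])⟩

variable [IsLocalRing R]

lemma isUnit_of_notMem_maximalIdeal {u : R} (h : u ∉ maximalIdeal R) : IsUnit u :=
  not_not.1 (mt (mem_maximalIdeal u).2 h)

lemma HasMultiplicity.exists_colen_eq {e : ℕ} (he : HasMultiplicity R e)
    (hfin : ∀ n, FinColen (maximalIdeal R ^ n)) :
    ∃ N, ∀ n ≥ N, colen (maximalIdeal R ^ (n + 1)) = colen (maximalIdeal R ^ n) + e := by
  obtain ⟨N, hN⟩ := he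
  refine ⟨N, fun n hn => ?_⟩
  have := hN n hn
  rw [rlength_eq_coe_length, rlength_eq_coe_length] at this
  rw [← coe_colen (hfin _), ← coe_colen (hfin _)] at this
  exact_mod_cast this

lemma colen_maximalIdeal_mul_le_add_one {J : Ideal R} (hfin : FinColen (maximalIdeal R * J))
    {v : R} (hv : v ∈ J) (hJ : J ≤ Ideal.span {v}) :
    colen (maximalIdeal R * J) ≤ colen J + 1 :=
  colen_le_add_one hfin Ideal.mul_le_right (w := v) (fun _ ha => Ideal.mul_mem_mul ha hv)
    fun r hr => by
      obtain ⟨c, rfl⟩ := Ideal.mem_span_singleton.1 (hJ hr)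
      exact ⟨c, by simp [mul_comm]⟩

lemma colen_maximalIdeal_mul_le_add_two {J : Ideal R} (hfin : FinColen (maximalIdeal R * J))
    {v w : R} (hv : v ∈ J) (hw : w ∈ J) (hJ : J ≤ Ideal.span {v, w}) :
    colen (maximalIdeal R * J) ≤ colen J + 2 := by
  have h1 : colen (maximalIdeal R * J) ≤ colen (maximalIdeal R * J ⊔ Ideal.span {v}) + 1 := by
    refine colen_le_add_one hfin le_sup_left (w := v) (fun _ ha => Ideal.mul_mem_mul ha hv)
      fun r hr => ?_
    obtain ⟨j, hj, s, hs, rfl⟩ := Submodule.mem_sup.1 hr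
    obtain ⟨c, rfl⟩ := Ideal.mem_span_singleton.1 hs
    exact ⟨c, by rwa [mul_comm c, add_sub_cancel_right]⟩
  have h2 : colen (maximalIdeal R * J ⊔ Ideal.span {v}) ≤ colen J + 1 := by
    refine colen_le_add_one (hfin.mono le_sup_left)
      (sup_le Ideal.mul_le_right ((Ideal.span_singleton_le_iff_mem _).2 hv)) (w := w)
      (fun _ ha => Ideal.mem_sup_left (Ideal.mul_mem_mul ha hw)) fun r hr => ?_
    obtain ⟨a, b, rfl⟩ := Ideal.mem_span_pair.1 (hJ hr)
    exact ⟨b, by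
      rw [add_sub_cancel_right]
      exact Ideal.mem_sup_right (Ideal.mul_mem_left _ _ (Ideal.mem_span_singleton_self v))⟩
  omega

variable [IsNoetherianRing R]

lemma le_of_le_sup_maximalIdeal_mul {I J : Ideal R} (h : J ≤ I ⊔ maximalIdeal R * J) : J ≤ I :=
  Submodule.le_of_le_smul_of_le_jacobson_bot (IsNoetherian.noetherian J)
    (maximalIdeal_le_jacobson ⊥) h

lemma exists_le_span_singleton {J : Ideal R} (hfin : FinColen (maximalIdeal R * J))
    (h : colen (maximalIdeal R * J) ≤ colen J + 1) : ∃ v ∈ J, J ≤ Ideal.span {v} := by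
  by_cases hJ : J ≤ maximalIdeal R * J
  · exact ⟨0, J.zero_mem, le_of_le_sup_maximalIdeal_mul (hJ.trans le_sup_right)⟩
  obtain ⟨v, hv, hvJ⟩ := SetLike.not_le_iff_exists.1 hJ
  refine ⟨v, hv, le_of_le_sup_maximalIdeal_mul ?_⟩
  rw [sup_comm]
  have h1 := colen_add_one_le (lt_sup_span_singleton hvJ) hfin
  exact (eq_of_colen_le (sup_le Ideal.mul_le_right ((Ideal.span_singleton_le_iff_mem _).2 hv))
    (hfin.mono le_sup_left) (by omega)).ge

lemma exists_le_span_pair {J : Ideal R} (hfin : FinColen (maximalIdeal R * J))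
    (h : colen (maximalIdeal R * J) ≤ colen J + 2) :
    ∃ v ∈ J, ∃ w ∈ J, J ≤ Ideal.span {v, w} := by
  by_cases hJ : J ≤ maximalIdeal R * J
  · exact ⟨0, J.zero_mem, 0, J.zero_mem,
      le_of_le_sup_maximalIdeal_mul (hJ.trans le_sup_right)⟩
  obtain ⟨v, hv, hvJ⟩ := SetLike.not_le_iff_exists.1 hJ
  have h1 := colen_add_one_le (lt_sup_span_singleton hvJ) hfin
  have hle : maximalIdeal R * J ⊔ Ideal.span {v} ≤ J :=
    sup_le Ideal.mul_le_right ((Ideal.span_singleton_le_iff_mem _).2 hv)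
  by_cases hJ' : J ≤ maximalIdeal R * J ⊔ Ideal.span {v}
  · refine ⟨v, hv, 0, J.zero_mem, le_of_le_sup_maximalIdeal_mul ?_⟩
    rw [sup_comm]
    exact hJ'.trans (sup_le_sup_left (Ideal.span_mono (by simp)) _)
  obtain ⟨w, hw, hwJ⟩ := SetLike.not_le_iff_exists.1 hJ'
  refine ⟨v, hv, w, hw, le_of_le_sup_maximalIdeal_mul ?_⟩
  have hfin' := hfin.mono (le_sup_left (b := Ideal.span {v}))
  have h2 := colen_add_one_le (lt_sup_span_singleton hwJ) hfin'
  have := (eq_of_colen_le (sup_le hle ((Ideal.span_singleton_le_iff_mem _).2 hw))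
    (hfin'.mono le_sup_left) (by omega)).ge
  refine this.trans (sup_le (sup_le le_sup_right ?_) ?_) <;>
    exact (Ideal.span_mono (by simp)).trans le_sup_left

end Generators

section EliasSquare

variable {R : Type u} [CommRing R]

lemma chain_of_colen_le {L T : Ideal R} (hL : FinColen L) (h : colen L ≤ colen T + 2) :
    ∀ K K' : Ideal R, L ≤ K → K < K' → K' < T → K = L := by
  intro K K' hLK hKK' hK'T
  by_contra hne
  have h1 := colen_add_one_le (lt_of_le_of_ne hLK (Ne.symm hne)) hL
  have h2 := colen_add_one_le hKK' (hL.mono hLK)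
  have h3 := colen_add_one_le hK'T (hL.mono (hLK.trans hKK'.le))
  omega

variable [IsLocalRing R]

lemma mem_maximalIdeal_mul_colonSpan {I : Ideal R} {x : R} (hxm : x ∈ maximalIdeal R)
    (hx : ∀ r, x * r = 0 → r = 0)
    (hE : ∀ r, (∀ a ∈ maximalIdeal R, ∃ i ∈ I, r * a = x * i) → x ∣ r)
    (hd : colonSpan x (colonSpan x I) = I)
    (hd' : ∀ J : Ideal R, x ^ 2 ∈ J → colonSpan (x ^ 2) (colonSpan (x ^ 2) J) = J) :
    x ∈ maximalIdeal R * colonSpan x I := by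
  have hxD : x ∈ colonSpan x I := fun j _ => dvd_mul_right x j
  rw [← hd' (maximalIdeal R * colonSpan x I) (by rw [sq]; exact Ideal.mul_mem_mul hxm hxD)]
  intro r hr
  suffices x ∣ r by rw [sq]; exact mul_dvd_mul_left x this
  refine hE r fun a ha => ?_
  obtain ⟨c, hc⟩ := hr (a * x) (Ideal.mul_mem_mul ha hxD)
  have hrac : r * a = x * c :=
    sub_eq_zero.1 (hx _ (by linear_combination hc))
  refine ⟨c, ?_, hrac⟩
  rw [← hd]
  intro d hdD
  obtain ⟨s, hs⟩ := hr (a * d) (Ideal.mul_mem_mul ha hdD)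
  exact ⟨s, sub_eq_zero.1 (hx _ (by linear_combination hs - d * hrac))⟩

/-- If `t / x` acts on `T / x𝔪` and preserves `D`, some element of the maximal ideal maps `D` onto
`T / x𝔪`. -/
lemma exists_le_span_mul_sup {x t : R} {D T : Ideal R} (hx : ∀ r, x * r = 0 → r = 0)
    (hxt : ¬ x ∣ t) (htm : ∀ a ∈ maximalIdeal R, ∃ b ∈ maximalIdeal R, t * a = x * b)
    (hxmD : x ∈ maximalIdeal R * D) (htD : ∀ d ∈ D, ∃ d' ∈ D, t * d = x * d')
    (hDT : maximalIdeal R * D ≤ T) (hxT : x ∈ T) (hT : ∀ z ∈ T, ∃ c, x ∣ z - c * t)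
    (hLfin : FinColen (Ideal.span {x} * maximalIdeal R)) :
    ∃ a ∈ maximalIdeal R, T ≤ Ideal.span {a} * D ⊔ Ideal.span {x} * maximalIdeal R := by
  have hcancel : ∀ r s, x * r = x * s → r = s := fun r s h =>
    sub_eq_zero.1 (hx _ (by rw [mul_sub, h, sub_self]))
  set L := Ideal.span {x} * maximalIdeal R with hL
  have hmemL : ∀ {b}, b ∈ maximalIdeal R → x * b ∈ L := fun hb =>
    Ideal.mul_mem_mul (Ideal.mem_span_singleton_self x) hb
  have hxL : x ∉ L := fun h => by
    obtain ⟨b, hb, hb'⟩ := Ideal.mem_span_singleton_mul.1 h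
    have : b = 1 := hcancel _ _ (by rw [hb', mul_one])
    exact (Ideal.ne_top_iff_one _).1 (maximalIdeal.isMaximal R).ne_top (this ▸ hb)
  have hLT : L ≤ T := Ideal.mul_le_right.trans' (le_of_eq (mul_comm _ _)) |>.trans
    ((Ideal.span_singleton_le_iff_mem _).2 hxT)
  have hmT : ∀ a ∈ maximalIdeal R, ∀ z ∈ T, a * z ∈ L := by
    intro a ha z hz
    obtain ⟨c, s, hs⟩ := hT z hz
    obtain ⟨b, hb, hab⟩ := htm a ha
    have : a * z = x * (c * b + s * a) := by linear_combination a * hs + c * hab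
    rw [this]
    exact hmemL (Ideal.add_mem _ (Ideal.mul_mem_left _ _ hb) (Ideal.mul_mem_left _ _ ha))
  have hchain := chain_of_colen_le (T := T) hLfin (by
    have h1 : colen L ≤ colen (Ideal.span {x}) + 1 := by
      refine colen_le_add_one hLfin (Ideal.mul_le_left) (w := x)
        (fun a ha => by rw [mul_comm]; exact hmemL ha) fun r hr => ?_
      obtain ⟨c, rfl⟩ := Ideal.mem_span_singleton.1 hr
      exact ⟨c, by simp [mul_comm]⟩
    have h2 : colen (Ideal.span {x}) ≤ colen T + 1 := by
      refine colen_le_add_one (hLfin.mono Ideal.mul_le_left)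
        ((Ideal.span_singleton_le_iff_mem _).2 hxT) (w := t) (fun a ha => ?_) fun r hr => ?_
      · obtain ⟨b, -, hb⟩ := htm a ha
        exact Ideal.mem_span_singleton.2 ⟨b, by rw [mul_comm, hb]⟩
      · obtain ⟨c, hc⟩ := hT r hr
        exact ⟨c, Ideal.mem_span_singleton.2 hc⟩
    omega)
  have hmemA : ∀ {a d}, d ∈ D → a * d ∈ Ideal.span {a} * D ⊔ L := fun hd =>
    Ideal.mem_sup_left (Ideal.mul_mem_mul (Ideal.mem_span_singleton_self _) hd)
  have hAT' : ∀ a ∈ maximalIdeal R, Ideal.span {a} * D ⊔ L ≤ T := fun a ha =>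
    sup_le ((Ideal.mul_mono_left ((Ideal.span_singleton_le_iff_mem _).2 ha)).trans hDT) hLT
  have hAle : ∀ {a} {B : Ideal R}, L ≤ B → (∀ d ∈ D, a * d ∈ B) →
      Ideal.span {a} * D ⊔ L ≤ B := fun hLB h =>
    sup_le (Ideal.span_singleton_mul_le_iff.2 h) hLB
  have htL : ∀ z ∈ L, ∃ z' ∈ L, t * z = x * z' := by
    intro z hz
    obtain ⟨b, hb, rfl⟩ := Ideal.mem_span_singleton_mul.1 hz
    obtain ⟨b', hb', h⟩ := htm b hb
    exact ⟨x * b', hmemL hb', by linear_combination x * h⟩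
  have htA : ∀ a, ∀ z ∈ Ideal.span {a} * D ⊔ L, ∃ z' ∈ Ideal.span {a} * D ⊔ L,
      t * z = x * z' := by
    intro a z hz
    obtain ⟨w, hw, l, hl, rfl⟩ := Submodule.mem_sup.1 hz
    obtain ⟨d, hd, rfl⟩ := Ideal.mem_span_singleton_mul.1 hw
    obtain ⟨d', hd', h⟩ := htD d hd
    obtain ⟨l', hl', h'⟩ := htL l hl
    exact ⟨a * d' + l', Ideal.add_mem _ (hmemA hd') (Ideal.mem_sup_right hl'),
      by linear_combination a * h + h'⟩
  by_contra hcon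
  push Not at hcon
  have hAT : ∀ a ∈ maximalIdeal R, Ideal.span {a} * D ⊔ L < T := fun a ha =>
    lt_of_le_not_ge (hAT' a ha) (hcon a ha)
  obtain ⟨a, ha, d₀, hd₀, had₀⟩ : ∃ a ∈ maximalIdeal R, ∃ d ∈ D, a * d ∉ L := by
    by_contra h
    push Not at h
    exact hxL (Ideal.mul_le.2 h hxmD)
  have hA : ∃ b ∈ maximalIdeal R, ∃ d ∈ D, b * d ∉ Ideal.span {a} * D ⊔ L := by
    by_contra h
    push Not at h
    have hmD : maximalIdeal R * D ≤ Ideal.span {a} * D ⊔ L := Ideal.mul_le.2 h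
    obtain ⟨y, hy, hxy⟩ := htA a x (hmD hxmD)
    have hty : y = t := hcancel _ _ (by rw [← hxy, mul_comm])
    refine hcon a ha fun z hz => ?_
    obtain ⟨c, s, hs⟩ := hT z hz
    rw [sub_eq_iff_eq_add.1 hs]
    exact Ideal.add_mem _ (Ideal.mul_mem_right _ _ (hmD hxmD))
      (Ideal.mul_mem_left _ _ (hty ▸ hy))
  obtain ⟨b, hb, d₁, hd₁, hbd₁⟩ := hA
  have hBA : ¬ Ideal.span {b} * D ⊔ L ≤ Ideal.span {a} * D ⊔ L := fun h => hbd₁ (h (hmemA hd₁))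
  have hAB : ¬ Ideal.span {a} * D ⊔ L ≤ Ideal.span {b} * D ⊔ L := fun h => by
    have := hchain _ _ le_sup_right (lt_of_le_not_ge h hBA) (hAT b hb)
    exact had₀ (this ▸ hmemA hd₀)
  have hab : a + b ∈ maximalIdeal R := Ideal.add_mem _ ha hb
  obtain ⟨d, hd, hdL⟩ : ∃ d ∈ D, (a + b) * d ∉ L := by
    by_contra h
    push Not at h
    refine hAB (hAle le_sup_right fun d hd => ?_)
    have := Ideal.sub_mem _ (Ideal.mem_sup_right (h d hd)) (hmemA (a := b) hd)
    rwa [add_mul, add_sub_cancel_right] at this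
  have hpL : a * d ∉ L := fun h => by
    have h1 : (a + b) * d ∈ Ideal.span {b} * D ⊔ L := by
      rw [add_mul]
      exact Ideal.add_mem _ (Ideal.mem_sup_right h) (hmemA hd)
    have h2 := le_of_chain_of_mem hchain le_sup_right (hAT _ hab) le_sup_right (hmemA hd) h1 hdL
    refine hAB (hAle le_sup_right fun d' hd' => ?_)
    have := Ideal.sub_mem _ (h2 (hmemA hd')) (hmemA (a := b) hd')
    rwa [add_mul, add_sub_cancel_right] at this
  have hqL : b * d ∉ L := fun h => by
    have h1 : (a + b) * d ∈ Ideal.span {a} * D ⊔ L := by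
      rw [add_mul]
      exact Ideal.add_mem _ (hmemA hd) (Ideal.mem_sup_right h)
    have h2 := le_of_chain_of_mem hchain le_sup_right (hAT _ hab) le_sup_right (hmemA hd) h1 hdL
    refine hBA (hAle le_sup_right fun d' hd' => ?_)
    have := Ideal.sub_mem _ (h2 (hmemA hd')) (hmemA (a := a) hd')
    rwa [add_mul, add_sub_cancel_left] at this
  obtain ⟨ν, hν⟩ := exists_scalar_of_invariant_lines hx hchain hmT htL (htA a) (htA b)
    (htA (a + b)) le_sup_right (hAT a ha) le_sup_right (hAT b hb) le_sup_right (hAT _ hab)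
    hAB hBA (hmemA hd) (hmemA hd) hpL hqL (by rw [← add_mul]; exact hmemA hd)
    (by rwa [← add_mul])
  obtain ⟨l, hl, hνl⟩ := hν x hxT
  obtain ⟨c, -, rfl⟩ := Ideal.mem_span_singleton_mul.1 hl
  exact hxt ⟨ν + c, hcancel _ _ (by linear_combination hνl)⟩

/-- If the maximal ideal is generated by `a` and `g` with `g𝔪 ⊆ a𝔪`, then its powers are generated
by two elements. -/
lemma maximalIdeal_pow_le_span_pair {a g : R}
    (hm : maximalIdeal R ≤ Ideal.span {a, g}) (hga : ∃ c ∈ maximalIdeal R, g * g = a * c) (n : ℕ) :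
    maximalIdeal R ^ (n + 1) ≤ Ideal.span {a ^ (n + 1), a ^ n * g} := by
  induction n with
  | zero => simpa using hm
  | succ n ih =>
    rw [pow_succ' _ (n + 1)]
    refine Ideal.mul_le.2 fun b hb c hc => ?_
    obtain ⟨α, β, rfl⟩ := Ideal.mem_span_pair.1 (hm hb)
    obtain ⟨γ, δ, rfl⟩ := Ideal.mem_span_pair.1 (ih hc)
    obtain ⟨s, hs, hgs⟩ := hga
    obtain ⟨ε, ζ, rfl⟩ := Ideal.mem_span_pair.1 (hm hs)
    refine Ideal.mem_span_pair.2 ⟨α * γ + β * δ * ε, α * δ + β * γ + β * δ * ζ, ?_⟩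
    linear_combination - β * δ * a ^ n * hgs

end EliasSquare

section MultiplicityBounds

variable {R : Type u} [CommRing R]

lemma eq_zero_of_pow_mul_eq_zero {y : R} (hy : ∀ r, y * r = 0 → r = 0) :
    ∀ n r, y ^ n * r = 0 → r = 0 := by
  intro n
  induction n with
  | zero => intro r hr; simpa using hr
  | succ n ih => exact fun r hr => ih r (hy _ (by rw [← hr]; ring))

variable [IsLocalRing R]

lemma forall_exists_mul_eq_of_socle {x t : R} (hx : ∀ r, x * r = 0 → r = 0)
    (hnp : ¬ ∃ a ∈ maximalIdeal R, maximalIdeal R ≤ Ideal.span {a})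
    (ht : ∀ a ∈ maximalIdeal R, x ∣ t * a) :
    ∀ a ∈ maximalIdeal R, ∃ b ∈ maximalIdeal R, t * a = x * b := by
  intro a ha
  obtain ⟨u, hu⟩ := ht a ha
  refine ⟨u, by_contra fun hum => hnp ⟨a, ha, fun b hb => ?_⟩, hu⟩
  obtain ⟨u, rfl⟩ := isUnit_of_notMem_maximalIdeal hum
  have hxt : x = t * a * ↑u⁻¹ := by rw [hu, Units.mul_inv_cancel_right]
  obtain ⟨s, hs⟩ := ht b hb
  refine Ideal.mem_span_singleton.2 ⟨↑u⁻¹ * s, sub_eq_zero.1 (hx _ ?_)⟩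
  calc x * (b - a * (↑u⁻¹ * s)) = a * ↑u⁻¹ * (t * b) - x * (a * (↑u⁻¹ * s)) := by
        rw [mul_sub]
        nth_rewrite 1 [hxt]
        ring
    _ = 0 := by rw [hs]; ring

lemma exists_le_span_pair_of_le_span_mul_sup {x t a : R} {D T : Ideal R}
    (hx : ∀ r, x * r = 0 → r = 0)
    (htm : ∀ a ∈ maximalIdeal R, ∃ b ∈ maximalIdeal R, t * a = x * b)
    (hDT : maximalIdeal R * D ≤ T) (hxT : x ∈ T) (hT : ∀ z ∈ T, ∃ c, x ∣ z - c * t)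
    (ha : a ∈ maximalIdeal R)
    (haD : T ≤ Ideal.span {a} * D ⊔ Ideal.span {x} * maximalIdeal R) :
    ∃ g ∈ maximalIdeal R, maximalIdeal R ≤ Ideal.span {a, g} ∧
      ∃ c ∈ maximalIdeal R, g * g = a * c := by
  have hcancel : ∀ r s, x * r = x * s → r = s := fun r s h =>
    sub_eq_zero.1 (hx _ (by rw [mul_sub, h, sub_self]))
  obtain ⟨d, hd, had⟩ : ∃ d ∈ D, a * d = x := by
    obtain ⟨w, hw, l, hl, hwl⟩ := Submodule.mem_sup.1 (haD hxT)
    obtain ⟨d, hd, rfl⟩ := Ideal.mem_span_singleton_mul.1 hw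
    obtain ⟨b, hb, rfl⟩ := Ideal.mem_span_singleton_mul.1 hl
    obtain ⟨u, hu⟩ := (isUnit_or_isUnit_one_sub_self b).resolve_left ((mem_maximalIdeal b).1 hb)
    refine ⟨↑u⁻¹ * d, D.mul_mem_left _ hd, ?_⟩
    have h : a * d = x * u := by rw [hu]; linear_combination hwl
    calc a * (↑u⁻¹ * d) = a * d * ↑u⁻¹ := by ring
      _ = x := by rw [h, Units.mul_inv_cancel_right]
  obtain ⟨g, hg, hag⟩ := htm a ha
  refine ⟨g, hg, fun b hb => ?_, ?_⟩
  · obtain ⟨c, s, hs⟩ := hT (b * d) (hDT (Ideal.mul_mem_mul hb hd))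
    refine Ideal.mem_span_pair.2 ⟨s, c, hcancel _ _ ?_⟩
    linear_combination b * had - c * hag - a * hs
  · obtain ⟨c, hc, hgc⟩ := htm g hg
    exact ⟨c, hc, hcancel _ _ (by linear_combination a * hgc - g * hag)⟩

lemma mult_le_one_of_principal {e N : ℕ} (hfin : ∀ n, FinColen (maximalIdeal R ^ n))
    (hN : ∀ n ≥ N, colen (maximalIdeal R ^ (n + 1)) = colen (maximalIdeal R ^ n) + e)
    {a : R} (ha : a ∈ maximalIdeal R) (hm : maximalIdeal R ≤ Ideal.span {a}) : e ≤ 1 := by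
  have h := colen_maximalIdeal_mul_le_add_one (J := maximalIdeal R ^ N)
    (by rw [← pow_succ']; exact hfin _) (Ideal.pow_mem_pow ha N)
    (by rw [← Ideal.span_singleton_pow]; exact Ideal.pow_right_mono hm N)
  rw [← pow_succ', hN N le_rfl] at h
  omega

lemma mult_le_two_of_eliasIdeal_sq [IsNoetherianRing R] (hdim : ringKrullDim R = 1)
    (hGor : modType R (ModuleCat.of R R) = 1) {e N : ℕ}
    (hfin : ∀ n, FinColen (maximalIdeal R ^ n))
    (hN : ∀ n ≥ N, colen (maximalIdeal R ^ (n + 1)) = colen (maximalIdeal R ^ n) + e)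
    {y : R} (hym : y ∈ maximalIdeal R) (hy : ∀ r, y * r = 0 → r = 0)
    (hE : EliasIdeal R (maximalIdeal R ^ 2)) : e ≤ 2 := by
  by_cases hp : ∃ a ∈ maximalIdeal R, maximalIdeal R ≤ Ideal.span {a}
  · obtain ⟨a, ha, hm⟩ := hp
    exact (mult_le_one_of_principal hfin hN ha hm).trans one_le_two
  have hpow := eq_zero_of_pow_mul_eq_zero hy
  set x := y ^ 3 with hxy
  have hx : ∀ r, x * r = 0 → r = 0 := hpow 3
  have hx2 : ∀ r, x ^ 2 * r = 0 → r = 0 := by rw [hxy, ← pow_mul]; exact hpow _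
  have hcancel : ∀ r s, x * r = x * s → r = s := fun r s h =>
    sub_eq_zero.1 (hx _ (by rw [mul_sub, h, sub_self]))
  have hxm2 : x ∈ maximalIdeal R ^ 2 :=
    Ideal.pow_le_pow_right (by norm_num) (Ideal.pow_mem_pow hym 3)
  have hm2 : maximalIdeal R ^ 2 ≤ maximalIdeal R := Ideal.pow_le_self two_ne_zero
  have hxm : x ∈ maximalIdeal R := hm2 hxm2
  rw [eliasIdeal_iff hm2 (hfin 2) hxm2 hx] at hE
  obtain ⟨⟨t, ht, hxt⟩, hsoc⟩ := socle_of_modType_eq_one hGor hxm hx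
  have hsoc2 := (socle_of_modType_eq_one hGor (Ideal.pow_mem_of_mem _ hxm 2 two_pos) hx2).2
  have hxfin := finColen_span_singleton hdim hx
  have htm := forall_exists_mul_eq_of_socle hx hp ht
  have hxmD := mem_maximalIdeal_mul_colonSpan hxm hx hE (colonSpan_colonSpan hxfin hsoc hxm2)
    fun J hJ => colonSpan_colonSpan (finColen_span_singleton hdim hx2) hsoc2 hJ
  have hT : ∀ z ∈ colonSpan x (maximalIdeal R), ∃ c, x ∣ z - c * t := fun z hz =>
    hsoc t z ht hz hxt
  have hDT : maximalIdeal R * colonSpan x (maximalIdeal R ^ 2) ≤ colonSpan x (maximalIdeal R) := by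
    refine Ideal.mul_le.2 fun a ha d hd b hb => ?_
    rw [mul_comm a, mul_assoc]
    exact hd _ (by rw [sq]; exact Ideal.mul_mem_mul ha hb)
  have hxT : x ∈ colonSpan x (maximalIdeal R) := fun j _ => dvd_mul_right x j
  have hDm : colonSpan x (maximalIdeal R ^ 2) ≤ maximalIdeal R := by
    intro d hd
    by_contra hdm
    obtain ⟨s, hs⟩ := (isUnit_of_notMem_maximalIdeal hdm).dvd_mul_left.1
      (hd _ (Ideal.pow_mem_pow hym 2))
    have h1 := hpow 2 (1 - y * s) (by linear_combination hs + s * hxy)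
    refine (Ideal.ne_top_iff_one _).1 (maximalIdeal.isMaximal R).ne_top ?_
    rw [sub_eq_zero.1 h1]
    exact Ideal.mul_mem_right _ _ hym
  have htD : ∀ d ∈ colonSpan x (maximalIdeal R ^ 2), ∃ d' ∈ colonSpan x (maximalIdeal R ^ 2),
      t * d = x * d' := by
    intro d hd
    obtain ⟨d', -, hdd'⟩ := htm d (hDm hd)
    refine ⟨d', fun j hj => ?_, hdd'⟩
    suffices maximalIdeal R ^ 2 ≤ colonSpan x (Ideal.span {d'}) by
      rw [mul_comm]
      exact this hj d' (Ideal.mem_span_singleton_self _)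
    rw [sq]
    refine Ideal.mul_le.2 fun a ha b hb k hk => ?_
    obtain ⟨k, rfl⟩ := Ideal.mem_span_singleton.1 hk
    obtain ⟨c, r, hr⟩ := hT (a * d) (hDT (Ideal.mul_mem_mul ha hd))
    obtain ⟨b', hb', hbb'⟩ := htm b hb
    obtain ⟨s, -, hs⟩ := htm (c * b' + r * b)
      (Ideal.add_mem _ (Ideal.mul_mem_left _ _ hb') (Ideal.mul_mem_left _ _ hb))
    refine ⟨s * k, hcancel _ _ ?_⟩
    linear_combination x * k * hs - a * b * k * hdd' + t * b * k * hr + t * c * k * hbb'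
  obtain ⟨a, ha, haD⟩ := exists_le_span_mul_sup hx hxt htm hxmD htD hDT hxT hT
    ((finColen_span_singleton hdim (x := x * y) fun r hr => hy r (hx _ (by rw [← hr]; ring))).mono
      ((Ideal.span_singleton_le_iff_mem _).2
        (Ideal.mul_mem_mul (Ideal.mem_span_singleton_self x) hym)))
  obtain ⟨g, hgm, hm, hg⟩ := exists_le_span_pair_of_le_span_mul_sup hx htm hDT hxT hT ha haD
  have h := colen_maximalIdeal_mul_le_add_two (J := maximalIdeal R ^ (N + 1))
    (by rw [← pow_succ']; exact hfin _) (Ideal.pow_mem_pow ha _)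
    (by rw [pow_succ]; exact Ideal.mul_mem_mul (Ideal.pow_mem_pow ha N) hgm)
    (maximalIdeal_pow_le_span_pair hm hg N)
  rw [← pow_succ', hN (N + 1) (Nat.le_succ N)] at h
  omega

end MultiplicityBounds

section SmallMultiplicity

variable {R : Type u} [CommRing R] [IsLocalRing R]

lemma exists_le_span_singleton_of_eliasIdeal_maximalIdeal
    (hGor : modType R (ModuleCat.of R R) = 1) (hfin : FinColen (maximalIdeal R)) {x : R}
    (hxm : x ∈ maximalIdeal R) (hx : ∀ r, x * r = 0 → r = 0) (hE : EliasIdeal R (maximalIdeal R)) :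
    ∃ a ∈ maximalIdeal R, maximalIdeal R ≤ Ideal.span {a} := by
  obtain ⟨t, ht, hxt⟩ := (socle_of_modType_eq_one hGor hxm hx).1
  by_contra hnp
  exact hxt ((eliasIdeal_iff le_rfl hfin hxm hx).1 hE t (forall_exists_mul_eq_of_socle hx hnp ht))

variable [IsNoetherianRing R]

lemma exists_reduction_or_of_le_span_pair {n : ℕ} {v w : R}
    (hfin : FinColen (maximalIdeal R ^ (n + 2)))
    (hlen : colen (maximalIdeal R ^ (n + 2)) ≤ colen (maximalIdeal R ^ (n + 1)) + 2)
    (hv : v ∈ maximalIdeal R ^ n) (hw : w ∈ maximalIdeal R ^ n)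
    (hvw : maximalIdeal R ^ n ≤ Ideal.span {v, w}) :
    (∃ v ∈ maximalIdeal R ^ n, maximalIdeal R ^ (n + 1) ≤ Ideal.span {v} * maximalIdeal R) ∨
      ∃ y ∈ maximalIdeal R, maximalIdeal R ^ (n + 1) ≤ Ideal.span {y} * maximalIdeal R ^ n := by
  have hchain := chain_of_colen_le hfin hlen
  set T := maximalIdeal R ^ (n + 1) with hT
  set L := maximalIdeal R ^ (n + 2) with hL
  have hnak : ∀ I : Ideal R, T ≤ I ⊔ L → T ≤ I := fun I h =>
    le_of_le_sup_maximalIdeal_mul (by rwa [hT, ← pow_succ'])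
  have hLT : L ≤ T := Ideal.pow_le_pow_right (Nat.le_succ _)
  by_contra! hcon
  obtain ⟨hcon₁, hcon₂⟩ := hcon
  let A : R → Ideal R := fun u => Ideal.span {u} * maximalIdeal R ⊔ L
  have hLA : ∀ u, L ≤ A u := fun u => le_sup_right
  have hAT : ∀ u ∈ maximalIdeal R ^ n, A u < T := fun u hu =>
    lt_of_le_not_ge (sup_le (Ideal.span_singleton_mul_le_iff.2 fun b hb => by
      rw [hT, pow_succ]; exact Ideal.mul_mem_mul hu hb) hLT) fun h => hcon₁ u hu (hnak _ h)
  have hmemA : ∀ u, ∀ b ∈ maximalIdeal R, u * b ∈ A u := fun u b hb =>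
    Ideal.mem_sup_left (Ideal.mul_mem_mul (Ideal.mem_span_singleton_self u) hb)
  have hAle : ∀ u (B : Ideal R), L ≤ B → (∀ b ∈ maximalIdeal R, u * b ∈ B) → A u ≤ B :=
    fun u B hLB h => sup_le (Ideal.span_singleton_mul_le_iff.2 h) hLB
  have hTle : ∀ B : Ideal R, A v ≤ B → A w ≤ B → T ≤ B := by
    intro B hAB hBB
    rw [hT, pow_succ]
    refine Ideal.mul_le.2 fun z hz b hb => ?_
    obtain ⟨α, β, rfl⟩ := Ideal.mem_span_pair.1 (hvw hz)
    have : (α * v + β * w) * b = α * (v * b) + β * (w * b) := by ring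
    rw [this]
    exact B.add_mem (B.mul_mem_left _ (hAB (hmemA v b hb))) (B.mul_mem_left _ (hBB (hmemA w b hb)))
  obtain ⟨y, hy, hvy⟩ : ∃ y ∈ maximalIdeal R, v * y ∉ L := by
    by_contra! h
    exact (hAT w hw).not_ge (hTle _ (hAle v _ (hLA w) fun b hb => hLA w (h b hb)) le_rfl)
  have hwy : w * y ∉ L := fun hwy => by
    have hvw' := Ideal.add_mem _ hv hw
    have h1 : v * y ∈ A (v + w) := by
      have := Ideal.sub_mem _ (hmemA (v + w) y hy) (hLA (v + w) hwy)
      rwa [add_mul, add_sub_cancel_right] at this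
    have h2 := le_of_chain_of_mem hchain (hLA (v + w)) (hAT _ hvw') (hLA v) h1 (hmemA v y hy) hvy
    refine (hAT v hv).not_ge (hTle _ le_rfl (hAle w _ (hLA v) fun b hb => ?_))
    have := Ideal.sub_mem _ (h2 (hmemA (v + w) b hb)) (hmemA v b hb)
    rwa [add_mul, add_sub_cancel_left] at this
  have hmemE : ∀ u ∈ maximalIdeal R ^ n, u * y ∈ Ideal.span {y} * maximalIdeal R ^ n ⊔ L :=
    fun u hu => by
      rw [mul_comm u]
      exact Ideal.mem_sup_left (Ideal.mul_mem_mul (Ideal.mem_span_singleton_self y) hu)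
  refine hcon₂ y hy (hnak _ (hTle _ ?_ ?_))
  · exact le_of_chain_of_mem hchain (hLA v) (hAT v hv) le_sup_right (hmemA v y hy) (hmemE v hv) hvy
  · exact le_of_chain_of_mem hchain (hLA w) (hAT w hw) le_sup_right (hmemA w y hy) (hmemE w hw) hwy

lemma exists_reduction {N : ℕ} (hfin : ∀ n, FinColen (maximalIdeal R ^ n))
    (hN : ∀ n ≥ N, colen (maximalIdeal R ^ (n + 1)) = colen (maximalIdeal R ^ n) + 2) :
    ∃ y ∈ maximalIdeal R, ∃ n ≥ N,
      maximalIdeal R ^ (n + 1) ≤ Ideal.span {y} * maximalIdeal R ^ n := by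
  have hor : ∀ n ≥ N,
      (∃ v ∈ maximalIdeal R ^ n, maximalIdeal R ^ (n + 1) ≤ Ideal.span {v} * maximalIdeal R) ∨
      ∃ y ∈ maximalIdeal R, maximalIdeal R ^ (n + 1) ≤ Ideal.span {y} * maximalIdeal R ^ n := by
    intro n hn
    obtain ⟨v, hv, w, hw, hvw⟩ := exists_le_span_pair (J := maximalIdeal R ^ n)
      (by rw [← pow_succ']; exact hfin _) (by rw [← pow_succ']; exact (hN n hn).le)
    exact exists_reduction_or_of_le_span_pair (hfin _) (hN (n + 1) (hn.trans (Nat.le_succ n))).le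
      hv hw hvw
  rcases hor N le_rfl with ⟨v, hv, hvm⟩ | ⟨y, hy, h⟩
  · rcases hor (N + 1) (Nat.le_succ N) with ⟨w, hw, hwm⟩ | ⟨y, hy, h⟩
    · obtain ⟨y, hy, rfl⟩ := Ideal.mem_span_singleton_mul.1 (hvm hw)
      refine ⟨y, hy, N + 1, Nat.le_succ N, hwm.trans (Ideal.span_singleton_mul_le_iff.2 ?_)⟩
      intro b hb
      rw [mul_comm v, mul_assoc]
      refine Ideal.mul_mem_mul (Ideal.mem_span_singleton_self y) ?_
      rw [pow_succ]
      exact Ideal.mul_mem_mul hv hb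
    · exact ⟨y, hy, N + 1, Nat.le_succ N, h⟩
  · exact ⟨y, hy, N, le_rfl, h⟩

lemma eliasIdeal_sq_of_mult_eq_two (hdim : ringKrullDim R = 1) {N : ℕ}
    (hfin : ∀ n, FinColen (maximalIdeal R ^ n))
    (hN : ∀ n ≥ N, colen (maximalIdeal R ^ (n + 1)) = colen (maximalIdeal R ^ n) + 2)
    {x : R} (hxm : x ∈ maximalIdeal R) (hx : ∀ r, x * r = 0 → r = 0) :
    EliasIdeal R (maximalIdeal R ^ 2) := by
  obtain ⟨y, hym, n, hn, hred⟩ := exists_reduction hfin hN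
  have hy : ∀ r, y * r = 0 → r = 0 := by
    intro r hr
    obtain ⟨s, -, hs⟩ := Ideal.mem_span_singleton_mul.1 (hred (Ideal.pow_mem_pow hxm (n + 1)))
    exact eq_zero_of_pow_mul_eq_zero hx (n + 1) r (by rw [← hs]; linear_combination s * hr)
  have hyfin := finColen_span_singleton hdim hy
  have hlen := colen_span_mul hy (hfin n) hyfin
  rw [← le_antisymm hred (by
    rw [pow_succ']
    exact Ideal.mul_mono_left ((Ideal.span_singleton_le_iff_mem _).2 hym)), hN n hn] at hlen
  have hmy : maximalIdeal R ^ 2 ≤ Ideal.span {y} := by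
    by_contra hcon
    have h1 : Ideal.span {y} < Ideal.span {y} ⊔ maximalIdeal R ^ 2 :=
      lt_of_le_not_ge le_sup_left fun h => hcon (le_sup_right.trans h)
    have h2 : Ideal.span {y} ⊔ maximalIdeal R ^ 2 < maximalIdeal R := by
      refine lt_of_le_not_ge (sup_le ((Ideal.span_singleton_le_iff_mem _).2 hym)
        (Ideal.pow_le_self two_ne_zero)) fun h => hcon ?_
      rw [sq] at h
      exact (Ideal.pow_le_self two_ne_zero).trans (le_of_le_sup_maximalIdeal_mul h)
    have h3 : maximalIdeal R < ⊤ := (maximalIdeal.isMaximal R).ne_top.lt_top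
    have h1' := colen_add_one_le h1 hyfin
    have h2' := colen_add_one_le h2 (hyfin.mono h1.le)
    have h3' := colen_add_one_le h3 (hyfin.mono (h1.trans h2).le)
    omega
  rw [eliasIdeal_iff (Ideal.pow_le_self two_ne_zero) (hfin 2) (Ideal.pow_mem_pow hym 2)
    (eq_zero_of_pow_mul_eq_zero hy 2)]
  intro r hr
  obtain ⟨i, hi, hri⟩ := hr y hym
  obtain ⟨s, rfl⟩ := Ideal.mem_span_singleton.1 (hmy hi)
  exact ⟨s, sub_eq_zero.1 (hy _ (by linear_combination hri))⟩

lemma eliasIdeal_maximalIdeal_of_mult_eq_one {N : ℕ} (hfin : ∀ n, FinColen (maximalIdeal R ^ n))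
    (hN : ∀ n ≥ N, colen (maximalIdeal R ^ (n + 1)) = colen (maximalIdeal R ^ n) + 1)
    {x : R} (hxm : x ∈ maximalIdeal R) (hx : ∀ r, x * r = 0 → r = 0) :
    EliasIdeal R (maximalIdeal R) := by
  rw [eliasIdeal_iff le_rfl (by rw [← pow_one (maximalIdeal R)]; exact hfin 1) hxm hx]
  intro r hr
  obtain ⟨v, hv, hspan⟩ := exists_le_span_singleton (J := maximalIdeal R ^ (N + 1))
    (by rw [← pow_succ']; exact hfin _)
    (by rw [← pow_succ']; exact (hN (N + 1) (Nat.le_succ N)).le)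
  have hv0 : ∀ r, v * r = 0 → r = 0 := by
    intro r hr
    obtain ⟨s, hs⟩ := Ideal.mem_span_singleton.1 (hspan (Ideal.pow_mem_pow hxm (N + 1)))
    exact eq_zero_of_pow_mul_eq_zero hx (N + 1) r (by rw [hs]; linear_combination s * hr)
  have hrv : Ideal.span {r} * maximalIdeal R ^ (N + 1) ≤
      Ideal.span {x} * maximalIdeal R ^ (N + 1) := by
    rw [pow_succ', ← mul_assoc, ← mul_assoc]
    refine Ideal.mul_mono_left (Ideal.span_singleton_mul_le_iff.2 fun a ha => ?_)
    obtain ⟨i, hi, hri⟩ := hr a ha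
    rw [hri]
    exact Ideal.mul_mem_mul (Ideal.mem_span_singleton_self x) hi
  obtain ⟨s, hs, hxs⟩ := Ideal.mem_span_singleton_mul.1
    (hrv (Ideal.mul_mem_mul (Ideal.mem_span_singleton_self r) hv))
  obtain ⟨c, rfl⟩ := Ideal.mem_span_singleton.1 (hspan hs)
  exact ⟨c, sub_eq_zero.1 (hv0 _ (by linear_combination -hxs))⟩

lemma mult_ne_zero {e N : ℕ} (hfin : ∀ n, FinColen (maximalIdeal R ^ n))
    (hN : ∀ n ≥ N, colen (maximalIdeal R ^ (n + 1)) = colen (maximalIdeal R ^ n) + e)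
    {x : R} (hxm : x ∈ maximalIdeal R) (hx : ∀ r, x * r = 0 → r = 0) : e ≠ 0 := by
  rintro rfl
  have h := eq_of_colen_le (Ideal.pow_le_pow_right (Nat.le_succ N)) (hfin _) (hN N le_rfl).le
  have hle : maximalIdeal R ^ N ≤ ⊥ := by
    refine le_of_le_sup_maximalIdeal_mul ?_
    rw [← pow_succ', h]
    exact le_sup_right
  have h0 := Ideal.mem_bot.1 (hle (Ideal.pow_mem_pow hxm N))
  exact one_ne_zero (eq_zero_of_pow_mul_eq_zero hx N 1 (by rw [h0, zero_mul]))

end SmallMultiplicity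

theorem gorenstein_elias_index_two_iff_mult_two (R : Type u) [CommRing R] [IsLocalRing R] [IsNoetherianRing R]
    (hdim : ringKrullDim R = 1)
    (hCM : ∃ x ∈ maximalIdeal R, x ∈ nonZeroDivisors R)
    (hGor : modType R (ModuleCat.of R R) = 1)
    (e : ℕ) (he : HasMultiplicity R e) :
    (3 ≤ e → ¬ EliasIdeal R ((maximalIdeal R) ^ 2)) ∧
      (sInf {s : ℕ | 1 ≤ s ∧ EliasIdeal R ((maximalIdeal R) ^ s)} = 2 ↔ e = 2) := by
  obtain ⟨x, hxm, hx⟩ := hCM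
  replace hx := (mem_nonZeroDivisors_iff.1 hx).1
  have hfin : ∀ n, FinColen (maximalIdeal R ^ n) := fun n =>
    (finColen_span_singleton hdim (eq_zero_of_pow_mul_eq_zero hx n)).mono
      ((Ideal.span_singleton_le_iff_mem _).2 (Ideal.pow_mem_pow hxm n))
  obtain ⟨N, hN⟩ := he.exists_colen_eq hfin
  have hle := mult_le_two_of_eliasIdeal_sq hdim hGor hfin hN hxm hx
  refine ⟨fun h3 hE => absurd (hle hE) (by omega), fun h => ?_, ?_⟩
  · have hne : {s : ℕ | 1 ≤ s ∧ EliasIdeal R ((maximalIdeal R) ^ s)}.Nonempty :=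
      Nat.nonempty_of_sInf_eq_succ h
    have h2 : 2 ∈ {s : ℕ | 1 ≤ s ∧ EliasIdeal R ((maximalIdeal R) ^ s)} := h ▸ Nat.sInf_mem hne
    have h0 := mult_ne_zero hfin hN hxm hx
    have h1 : e ≠ 1 := by
      rintro rfl
      have hE := eliasIdeal_maximalIdeal_of_mult_eq_one hfin hN hxm hx
      rw [← pow_one (maximalIdeal R)] at hE
      have := Nat.sInf_le (s := {s : ℕ | 1 ≤ s ∧ EliasIdeal R ((maximalIdeal R) ^ s)}) ⟨le_rfl, hE⟩
      omega
    have := hle h2.2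
    omega
  · rintro rfl
    have h2 : 2 ∈ {s : ℕ | 1 ≤ s ∧ EliasIdeal R ((maximalIdeal R) ^ s)} :=
      ⟨one_le_two, eliasIdeal_sq_of_mult_eq_two hdim hfin hN hxm hx⟩
    refine le_antisymm (Nat.sInf_le h2) (le_csInf ⟨2, h2⟩ ?_)
    rintro s ⟨hs, hE⟩
    by_contra hlt
    obtain rfl : s = 1 := by omega
    rw [pow_one] at hE
    obtain ⟨a, ha, hm⟩ := exists_le_span_singleton_of_eliasIdeal_maximalIdeal hGor
      (by simpa using hfin 1) hxm hx hE
    have := mult_le_one_of_principal hfin hN ha hm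
    omega
end
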